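/- arXiv:1305.6691 — 3 statements merged into one kernel-verified Lean document; each statement's English description precedes it below -/
import Mathlib

section
/- Let X be a real Banach space, let A : X ⇉ X* be of type (FPV), and let B : X ⇉ X* be maximally monotone. Suppose dom A ∩ int(dom B) ≠ ∅. Then for every (z, z*) ∈ X × X* with z in the norm closure of dom B, one has F_{A+B}(z, z*) ≥ ⟨z, z*⟩. -/
open Set Filter Topology

noncomputable section

variable {X : Type*} [NormedAddCommGroup X] [NormedSpace ℝ X]

/-- A set-valued operator `A : X ⇉ X*`, identified with its graph,
is monotone if `⟨x − y, x* − y*⟩ ≥ 0` for all `(x, x*), (y, y*)` in the graph. -/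
def IsMonotoneOp (A : Set (X × (X →L[ℝ] ℝ))) : Prop :=
  ∀ p ∈ A, ∀ q ∈ A, 0 ≤ (p.2 - q.2) (p.1 - q.1)

/-- `A` is maximally monotone if it is monotone and its graph is not properly contained
in the graph of any monotone operator. -/
def IsMaxMonotoneOp (A : Set (X × (X →L[ℝ] ℝ))) : Prop :=
  IsMonotoneOp A ∧ ∀ B : Set (X × (X →L[ℝ] ℝ)), IsMonotoneOp B → A ⊆ B → B = A

/-- The domain of a set-valued operator. -/
def opDom (A : Set (X × (X →L[ℝ] ℝ))) : Set X :=
  {x | ∃ xs, (x, xs) ∈ A}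

/-- `(z, z*)` is monotonically related to `S` if `⟨z − y, z* − y*⟩ ≥ 0` for all `(y, y*) ∈ S`. -/
def MonotonicallyRelated (S : Set (X × (X →L[ℝ] ℝ))) (p : X × (X →L[ℝ] ℝ)) : Prop :=
  ∀ q ∈ S, 0 ≤ (p.2 - q.2) (p.1 - q.1)

/-- A maximally monotone operator `A` is of type (FPV) if for every open convex set `U`
meeting `dom A`, every `(x, x*)` with `x ∈ U` monotonically related to
`gra A ∩ (U × X*)` belongs to `gra A`. -/
def IsFPV (A : Set (X × (X →L[ℝ] ℝ))) : Prop :=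
  IsMaxMonotoneOp A ∧
    ∀ U : Set X, IsOpen U → Convex ℝ U → (U ∩ opDom A).Nonempty →
      ∀ x : X, ∀ xs : X →L[ℝ] ℝ, x ∈ U →
        MonotonicallyRelated (A ∩ (U ×ˢ (univ : Set (X →L[ℝ] ℝ)))) (x, xs) →
        (x, xs) ∈ A

/-- The graph of the sum `A + B`: `(A + B)x = {a* + b* : a* ∈ A x, b* ∈ B x}`. -/
def opSum (A B : Set (X × (X →L[ℝ] ℝ))) : Set (X × (X →L[ℝ] ℝ)) :=
  {p | ∃ as bs, (p.1, as) ∈ A ∧ (p.1, bs) ∈ B ∧ p.2 = as + bs}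

/-- The star (centre) of a set `C`: points `x ∈ C` with `[x, c] ⊆ C` for all `c ∈ C`. -/
def starSet (C : Set X) : Set X :=
  {x ∈ C | ∀ c ∈ C, segment ℝ x c ⊆ C}

/-- The Fitzpatrick function of `A`:
`F_A(x, x*) = sup_{(a, a*) ∈ gra A} (⟨x, a*⟩ + ⟨a, x*⟩ − ⟨a, a*⟩)`, with values in `(−∞, +∞]`. -/
def fitz (A : Set (X × (X →L[ℝ] ℝ))) (p : X × (X →L[ℝ] ℝ)) : EReal :=
  ⨆ q ∈ A, ((q.2 p.1 + p.2 q.1 - q.2 q.1 : ℝ) : EReal)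



/-- A point monotonically related to a maximally monotone operator belongs to it. -/
theorem aux_mem_of_related {X : Type*} [NormedAddCommGroup X] [NormedSpace ℝ X]
    {B : Set (X × (X →L[ℝ] ℝ))} (hB : IsMaxMonotoneOp B) {p : X × (X →L[ℝ] ℝ)}
    (hp : ∀ q ∈ B, 0 ≤ (p.2 - q.2) (p.1 - q.1)) : p ∈ B := by
  have h : insert p B = B := by
    refine hB.2 _ ?_ (subset_insert _ _)
    rintro a (rfl | ha) b (rfl | hb)
    · simp
    · exact hp b hb
    · have := hp a ha
      simp only [ContinuousLinearMap.sub_apply, map_sub] at this ⊢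
      linarith
    · exact hB.1 a ha b hb
  rw [← h]
  exact mem_insert _ _

/-- Local boundedness at interior points of the domain. -/
theorem aux_locBdd {X : Type*} [NormedAddCommGroup X] [NormedSpace ℝ X] [CompleteSpace X]
    {B : Set (X × (X →L[ℝ] ℝ))} (hB : IsMonotoneOp B) {x0 : X}
    (hx0 : x0 ∈ interior (opDom B)) :
    ∃ r > 0, ∃ M : ℝ, 0 ≤ M ∧ (∀ y, ‖y - x0‖ < r → y ∈ opDom B) ∧
      ∀ p ∈ B, ‖p.1 - x0‖ < r → ‖p.2‖ ≤ M := by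
  obtain ⟨r0, hr0, hball⟩ := Metric.isOpen_iff.1 isOpen_interior x0 hx0
  have hball' : ∀ y, ‖y - x0‖ < r0 → y ∈ opDom B := fun y hy =>
    interior_subset (hball (by rw [Metric.mem_ball, dist_eq_norm]; exact hy))
  obtain ⟨b0, hb0⟩ := hball' x0 (by simpa using hr0)
  let ι := {p : X × (X →L[ℝ] ℝ) // p ∈ B ∧ ‖p.1 - x0‖ ≤ 1}
  let q : ι → ℝ := fun p => (p.1.2 - b0) (p.1.1 - x0)
  have hq : ∀ p : ι, 0 ≤ q p := fun p => hB _ p.2.1 _ hb0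
  let g : ι → X →L[ℝ] ℝ := fun p => (1 + q p)⁻¹ • (p.1.2 - b0)
  -- one-sided bound near zero
  have h1 : ∀ y : X, ‖y‖ < r0 → ∃ C : ℝ, ∀ p : ι, g p y ≤ C := by
    intro y hy
    obtain ⟨ys, hys⟩ := hball' (x0 + y) (by simpa using hy)
    refine ⟨‖ys - b0‖ * (‖y‖ + 1) + 1, fun p => ?_⟩
    have hm := hB _ hys _ p.2.1
    have hn : (ys - b0) (x0 + y - p.1.1) ≤ ‖ys - b0‖ * (‖y‖ + 1) := by
      refine (le_abs_self _).trans (((ys - b0).le_opNorm _).trans ?_)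
      gcongr
      have : x0 + y - p.1.1 = y - (p.1.1 - x0) := by abel
      rw [this]
      exact (norm_sub_le _ _).trans (by linarith [p.2.2])
    have hc : 0 ≤ ‖ys - b0‖ * (‖y‖ + 1) := by positivity
    have hqp := hq p
    have hkey : (p.1.2 - b0) y ≤ ‖ys - b0‖ * (‖y‖ + 1) + q p := by
      simp only [q, ContinuousLinearMap.sub_apply, map_sub, map_add] at hm hn ⊢
      linarith
    change (1 + q p)⁻¹ * (p.1.2 - b0) y ≤ _
    rw [inv_mul_le_iff₀ (by linarith)]
    nlinarith
  have h2 : ∀ y : X, ∃ C, ∀ p : ι, ‖g p y‖ ≤ C := by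
    intro y
    set k : ℝ := r0 / (2 * (‖y‖ + 1)) with hk
    have hkpos : 0 < k := by positivity
    have hky : ‖k • y‖ < r0 := by
      rw [norm_smul, Real.norm_of_nonneg hkpos.le, hk, div_mul_eq_mul_div,
        div_lt_iff₀ (by positivity)]
      nlinarith [norm_nonneg y]
    obtain ⟨C1, hC1⟩ := h1 (k • y) hky
    obtain ⟨C2, hC2⟩ := h1 (-(k • y)) (by simpa using hky)
    refine ⟨max C1 C2 / k, fun p => ?_⟩
    have e1 := hC1 p
    have e2 := hC2 p
    rw [map_neg] at e2
    rw [map_smul, smul_eq_mul] at e1 e2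
    rw [Real.norm_eq_abs, le_div_iff₀ hkpos]
    rcases abs_cases (g p y) with ⟨h, _⟩ | ⟨h, _⟩ <;> rw [h]
    · exact le_trans (by linarith) (le_max_left C1 C2)
    · exact le_trans (by linarith) (le_max_right C1 C2)
  obtain ⟨N', hN'⟩ := banach_steinhaus h2
  set N := max N' 1 with hN
  have hN1 : 1 ≤ N := le_max_right _ _
  have hNN : ∀ p : ι, ‖g p‖ ≤ N := fun p => (hN' p).trans (le_max_left _ _)
  refine ⟨min r0 (1 / (2 * N)), lt_min hr0 (by positivity), 2 * N + ‖b0‖, by positivity,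
    fun y hy => hball' y (hy.trans_le (min_le_left _ _)), ?_⟩
  intro p hp hpr
  have hs : ‖p.1 - x0‖ < 1 / (2 * N) := hpr.trans_le (min_le_right _ _)
  have hs' : ‖p.1 - x0‖ * (2 * N) < 1 := by rwa [lt_div_iff₀ (by positivity)] at hs
  have hs1 : ‖p.1 - x0‖ ≤ 1 := by nlinarith [norm_nonneg (p.1 - x0)]
  have hg := hNN ⟨p, hp, hs1⟩
  have hqp := hq ⟨p, hp, hs1⟩
  have hqn : q ⟨p, hp, hs1⟩ ≤ ‖p.2 - b0‖ * ‖p.1 - x0‖ :=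
    (le_abs_self _).trans ((p.2 - b0).le_opNorm _)
  have hgn : ‖p.2 - b0‖ ≤ (1 + q ⟨p, hp, hs1⟩) * N := by
    have : ‖(1 + q ⟨p, hp, hs1⟩)⁻¹ • (p.2 - b0)‖ ≤ N := hg
    rw [norm_smul, norm_inv, Real.norm_of_nonneg (by linarith),
      inv_mul_le_iff₀ (by linarith)] at this
    exact this
  have hfin : ‖p.2 - b0‖ ≤ 2 * N := by
    have h0 := norm_nonneg (p.2 - b0)
    have : q ⟨p, hp, hs1⟩ * N ≤ ‖p.2 - b0‖ * (1 / 2) := by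
      calc q ⟨p, hp, hs1⟩ * N ≤ ‖p.2 - b0‖ * ‖p.1 - x0‖ * N := by gcongr
        _ = ‖p.2 - b0‖ * (‖p.1 - x0‖ * N) := by ring
        _ ≤ _ := by gcongr; linarith
    linarith
  calc ‖p.2‖ = ‖(p.2 - b0) + b0‖ := by simp
    _ ≤ _ := (norm_add_le _ _).trans (by linarith)

/-- Monotonicity inequality for convex combinations. -/
theorem aux_hull {X : Type*} [NormedAddCommGroup X] [NormedSpace ℝ X]
    {B : Set (X × (X →L[ℝ] ℝ))} (hB : IsMonotoneOp B) (u : X)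
    {w : X × (X →L[ℝ] ℝ) × ℝ}
    (hw : w ∈ convexHull ℝ ((fun p : X × (X →L[ℝ] ℝ) => (p.1 - u, p.2, p.2 (p.1 - u))) '' B)) :
    w.2.1 w.1 ≤ w.2.2 := by
  set T := ((fun p : X × (X →L[ℝ] ℝ) => (p.1 - u, p.2, p.2 (p.1 - u))) '' B) with hT
  have hconv : ∀ v : X × (X →L[ℝ] ℝ) × ℝ, Convex ℝ
      {y : X × (X →L[ℝ] ℝ) × ℝ | 0 ≤ y.2.2 - v.2.1 y.1 - y.2.1 v.1 + v.2.2} := by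
    intro v y hy y' hy' a b ha hb hab
    simp only [mem_setOf_eq, Prod.fst_add, Prod.snd_add, Prod.smul_fst, Prod.smul_snd, map_add,
      map_smul, smul_eq_mul, ContinuousLinearMap.add_apply, ContinuousLinearMap.smul_apply]
      at hy hy' ⊢
    have e1 := mul_nonneg ha hy
    have e2 := mul_nonneg hb hy'
    have e3 : v.2.2 = a * v.2.2 + b * v.2.2 := by rw [← add_mul, hab, one_mul]
    rw [e3]
    linarith
  have s1 : ∀ v ∈ T, ∀ y ∈ convexHull ℝ T,
      0 ≤ y.2.2 - v.2.1 y.1 - y.2.1 v.1 + v.2.2 := by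
    intro v hv y hy
    refine convexHull_min (t := {y : X × (X →L[ℝ] ℝ) × ℝ |
      0 ≤ y.2.2 - v.2.1 y.1 - y.2.1 v.1 + v.2.2}) ?_ (hconv v) hy
    obtain ⟨p, hp, rfl⟩ := hv
    rintro _ ⟨p', hp', rfl⟩
    have := hB p' hp' p hp
    simp only [mem_setOf_eq, ContinuousLinearMap.sub_apply, map_sub] at this ⊢
    linarith
  have s2 : 0 ≤ w.2.2 - w.2.1 w.1 - w.2.1 w.1 + w.2.2 := by
    refine convexHull_min (t := {y : X × (X →L[ℝ] ℝ) × ℝ |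
      0 ≤ y.2.2 - w.2.1 y.1 - y.2.1 w.1 + w.2.2}) ?_ (hconv w) hw
    intro v hv
    have := s1 v hv w hw
    simp only [mem_setOf_eq]
    linarith
  linarith

/-- Hahn-Banach step. -/
theorem aux_HB {X : Type*} [NormedAddCommGroup X] [NormedSpace ℝ X]
    {B : Set (X × (X →L[ℝ] ℝ))} (hB : IsMaxMonotoneOp B) (u : X) {ρ C : ℝ}
    (hρ : 0 < ρ) (hC : 0 ≤ C)
    (h : ∀ v, ‖v - u‖ ≤ ρ → ∃ p ∈ B, ∃ q ∈ B, ∃ s : ℝ, 0 ≤ s ∧ s ≤ 1 ∧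
      s • p.1 + (1 - s) • q.1 = v ∧ s * p.2 (p.1 - u) + (1 - s) * q.2 (q.1 - u) ≤ C) :
    ∃ us, (u, us) ∈ B ∧ ‖us‖ ≤ C / ρ := by
  set T := ((fun p : X × (X →L[ℝ] ℝ) => (p.1 - u, p.2, p.2 (p.1 - u))) '' B) with hT
  set K := C / ρ with hK
  have hK0 : 0 ≤ K := by positivity
  let E : Set (X × ℝ) := {y | ∃ ys, (y.1, ys, y.2) ∈ convexHull ℝ T}
  have hE : Convex ℝ E := by
    rintro y ⟨ys, hy⟩ y' ⟨ys', hy'⟩ a b ha hb hab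
    exact ⟨a • ys + b • ys', convex_convexHull ℝ T hy hy' ha hb hab⟩
  have hEB : ∀ p ∈ B, (p.1 - u, p.2 (p.1 - u)) ∈ E := fun p hp =>
    ⟨p.2, subset_convexHull ℝ T ⟨p, hp, rfl⟩⟩
  have hE0 : ∀ β, ((0 : X), β) ∈ E → 0 ≤ β := by
    rintro β ⟨ys, hy⟩
    simpa using aux_hull hB.1 u hy
  have hElow : ∀ y ∈ E, -K * ‖y.1‖ ≤ y.2 := by
    rintro ⟨x, β⟩ hy
    simp only
    by_cases hx : x = 0
    · subst hx
      simpa using hE0 β hy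
    have hxn : 0 < ‖x‖ := norm_pos_iff.2 hx
    obtain ⟨p, hp, q, hq, s, hs0, hs1, hv, hle⟩ := h (u - (ρ / ‖x‖) • x) (by
      rw [sub_sub_cancel_left, norm_neg, norm_smul, Real.norm_of_nonneg (by positivity),
        div_mul_cancel₀ _ hxn.ne'])
    have hmem := hE (hEB p hp) (hEB q hq) hs0 (sub_nonneg.2 hs1) (by ring)
    have hfst : s • (p.1 - u) + (1 - s) • (q.1 - u) = -((ρ / ‖x‖) • x) := by
      have : s • (p.1 - u) + (1 - s) • (q.1 - u) = (s • p.1 + (1 - s) • q.1) - u := by module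
      rw [this, hv]; abel
    simp only [Prod.smul_mk, Prod.mk_add_mk, hfst, smul_eq_mul] at hmem
    have hd : 0 < ρ + ‖x‖ := by positivity
    have hmem2 := hE hy hmem (a := ρ / (ρ + ‖x‖)) (b := ‖x‖ / (ρ + ‖x‖)) (by positivity)
      (by positivity) (by field_simp)
    have hz : (ρ / (ρ + ‖x‖)) • x + (‖x‖ / (ρ + ‖x‖)) • (-((ρ / ‖x‖) • x)) = 0 := by
      rw [smul_neg, smul_smul, ← sub_eq_add_neg, ← sub_smul]
      have : ρ / (ρ + ‖x‖) - ‖x‖ / (ρ + ‖x‖) * (ρ / ‖x‖) = 0 := by field_simp; ring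
      rw [this, zero_smul]
    simp only [Prod.smul_mk, Prod.mk_add_mk, hz, smul_eq_mul] at hmem2
    have h0 := hE0 _ hmem2
    set γ := s * p.2 (p.1 - u) + (1 - s) * q.2 (q.1 - u) with hγ
    have h1 : 0 ≤ ρ * β + ‖x‖ * γ := by
      have : ρ / (ρ + ‖x‖) * β + ‖x‖ / (ρ + ‖x‖) * γ = (ρ * β + ‖x‖ * γ) / (ρ + ‖x‖) := by ring
      rw [this] at h0
      by_contra hneg
      exact absurd h0 (not_le.2 (div_neg_of_neg_of_pos (not_le.1 hneg) hd))
    have h2 : 0 ≤ ρ * β + ‖x‖ * C := by nlinarith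
    have h3 : K * ρ = C := by rw [hK]; field_simp
    rw [← h3] at h2
    have h4 : 0 ≤ ρ * (β + ‖x‖ * K) := by linarith
    have h5 := nonneg_of_mul_nonneg_right h4 hρ
    linarith
  let O : Set (X × ℝ) := {y | y.2 < -K * ‖y.1‖}
  have hOo : IsOpen O := isOpen_lt continuous_snd (by fun_prop)
  have hOc : Convex ℝ O := by
    rintro ⟨x, β⟩ hy ⟨x', β'⟩ hy' a b ha hb hab
    change β < -K * ‖x‖ at hy
    change β' < -K * ‖x'‖ at hy'
    change a * β + b * β' < -K * ‖a • x + b • x'‖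
    have hn : ‖a • x + b • x'‖ ≤ a * ‖x‖ + b * ‖x'‖ := by
      refine (norm_add_le _ _).trans (le_of_eq ?_)
      rw [norm_smul, norm_smul, Real.norm_of_nonneg ha, Real.norm_of_nonneg hb]
    have hn2 := mul_le_mul_of_nonneg_left hn hK0
    rcases ha.eq_or_lt with rfl | ha'
    · have : b = 1 := by linarith
      subst this
      linarith
    · have e1 := mul_lt_mul_of_pos_left hy ha'
      have e2 := mul_le_mul_of_nonneg_left hy'.le hb
      linarith
  have hdisj : Disjoint O E := by
    rw [Set.disjoint_left]
    intro y hy hyE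
    exact absurd (hElow y hyE) (not_le.2 hy)
  obtain ⟨f, c, hfO, hfE⟩ := geometric_hahn_banach_open hOc hOo hE hdisj
  let g : X →L[ℝ] ℝ := f.comp (ContinuousLinearMap.inl ℝ X ℝ)
  set γ := f ((0 : X), (1 : ℝ)) with hγ
  have hf : ∀ x β, f (x, β) = g x + β * γ := by
    intro x β
    have : ((x, β) : X × ℝ) = (x, 0) + β • ((0 : X), (1 : ℝ)) := by simp
    rw [this, map_add, map_smul]
    rfl
  have hc0 : 0 ≤ c := by
    by_contra hneg
    push Not at hneg
    have := hfO ((0 : X), c / (|γ| + 1)) (by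
      change c / (|γ| + 1) < -K * ‖(0 : X)‖
      simp only [norm_zero, mul_zero]
      exact div_neg_of_neg_of_pos hneg (by positivity))
    rw [hf, map_zero, zero_add, div_mul_eq_mul_div, div_lt_iff₀ (by positivity)] at this
    nlinarith [le_abs_self γ]
  have hfO' : ∀ y ∈ O, f y ≤ 0 := by
    rintro ⟨x, β⟩ hy
    by_contra hpos
    push Not at hpos
    have hk : 0 < (c + 1) / f (x, β) := by positivity
    have := hfO (((c + 1) / f (x, β)) • (x, β)) (by
      change (c + 1) / f (x, β) * β < -K * ‖((c + 1) / f (x, β)) • x‖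
      rw [norm_smul, Real.norm_of_nonneg hk.le]
      have := mul_lt_mul_of_pos_left (show β < -K * ‖x‖ from hy) hk
      linarith)
    rw [map_smul, smul_eq_mul, div_mul_cancel₀ _ hpos.ne'] at this
    linarith
  have hup : ∀ x, g x ≤ γ * (K * ‖x‖) := by
    intro x
    have hlim : ∀ e > 0, g x - γ * (K * ‖x‖) ≤ e * γ := by
      intro e he
      have := hfO' (x, -K * ‖x‖ - e) (by change -K * ‖x‖ - e < -K * ‖x‖; linarith)
      rw [hf] at this
      linarith
    by_contra hneg
    push Not at hneg
    obtain ⟨d, hd⟩ : ∃ d, d = g x - γ * (K * ‖x‖) := ⟨_, rfl⟩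
    have hdpos : 0 < d := by linarith
    rw [← hd] at hlim
    have := hlim (d / (2 * (|γ| + 1))) (div_pos hdpos (by positivity))
    rw [div_mul_eq_mul_div, le_div_iff₀ (by positivity)] at this
    nlinarith [le_abs_self γ, abs_nonneg γ]
  have hγ0 : 0 ≤ γ := by
    have := hfO' ((0 : X), -1) (by change (-1 : ℝ) < -K * ‖(0 : X)‖; simp)
    rw [hf] at this
    simp at this
    linarith
  have hγpos : 0 < γ := by
    rcases hγ0.eq_or_lt with h0 | h0
    · exfalso
      have hg0 : ∀ x, g x = 0 := by
        intro x
        have e1 := hup x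
        have e2 := hup (-x)
        rw [← h0] at e1 e2
        rw [map_neg] at e2
        linarith
      have e3 := hfO ((0 : X), -1) (by change (-1 : ℝ) < -K * ‖(0 : X)‖; simp)
      obtain ⟨p, hp, _⟩ := h u (by simpa using hρ.le)
      have e4 := hfE _ (hEB p hp)
      rw [hf, hg0, ← h0] at e3 e4
      linarith
    · exact h0
  refine ⟨-(γ⁻¹ • g), ?_, ?_⟩
  · apply aux_mem_of_related hB
    intro q hq
    have e := hc0.trans (hfE _ (hEB q hq))
    rw [hf] at e
    have e1 : 0 ≤ γ⁻¹ * (g (q.1 - u) + q.2 (q.1 - u) * γ) := by positivity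
    have e2 : γ⁻¹ * (g (q.1 - u) + q.2 (q.1 - u) * γ) = γ⁻¹ * g (q.1 - u) + q.2 (q.1 - u) := by
      field_simp
    rw [e2] at e1
    simp only [ContinuousLinearMap.sub_apply, ContinuousLinearMap.neg_apply,
      ContinuousLinearMap.smul_apply, smul_eq_mul, map_sub] at e1 ⊢
    linarith
  · refine ContinuousLinearMap.opNorm_le_bound _ hK0 fun x => ?_
    have e1 : γ⁻¹ * g x ≤ K * ‖x‖ := by
      rw [inv_mul_le_iff₀ hγpos]; exact hup x
    have e2 : γ⁻¹ * g (-x) ≤ K * ‖x‖ := by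
      rw [inv_mul_le_iff₀ hγpos]; simpa using hup (-x)
    rw [map_neg] at e2
    simp only [ContinuousLinearMap.neg_apply, ContinuousLinearMap.smul_apply, smul_eq_mul,
      Real.norm_eq_abs, abs_neg]
    rw [abs_le]
    constructor <;> linarith

/-- Bounded selections of `B` near the segment `[x0, x0 + t (z - x0)]`. -/
theorem aux_tube {X : Type*} [NormedAddCommGroup X] [NormedSpace ℝ X] [CompleteSpace X]
    {B : Set (X × (X →L[ℝ] ℝ))} (hB : IsMaxMonotoneOp B) {x0 z : X}
    (hx0 : x0 ∈ interior (opDom B)) (hz : z ∈ closure (opDom B)) {t : ℝ} (ht : t < 1) :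
    ∃ ρ > 0, ∃ K : ℝ, 0 ≤ K ∧ ∀ s : ℝ, 0 ≤ s → s ≤ t → ∀ u,
      ‖u - (x0 + s • (z - x0))‖ < ρ → ∃ us, (u, us) ∈ B ∧ ‖us‖ ≤ K := by
  obtain ⟨r, hr, M, hM, hdom, hbd⟩ := aux_locBdd hB.1 hx0
  set ρ := (1 - t) * r / 4 with hρdef
  have hρ : 0 < ρ := by
    have : 0 < 1 - t := by linarith
    positivity
  obtain ⟨z', ⟨zs', hz'⟩, hzz'⟩ := Metric.mem_closure_iff.1 hz ρ hρ
  rw [dist_eq_norm] at hzz'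
  set D := ‖z - x0‖ with hD
  set C := (2 * ρ + 2 * D) * ‖zs'‖ + (r + ρ + D) * M with hCdef
  have hC : 0 ≤ C := by positivity
  refine ⟨ρ, hρ, C / ρ, by positivity, ?_⟩
  intro s hs0 hst u hu
  have hux : ‖u - x0‖ ≤ ρ + D := by
    calc ‖u - x0‖ = ‖(u - (x0 + s • (z - x0))) + s • (z - x0)‖ := by congr 1; abel
      _ ≤ ‖u - (x0 + s • (z - x0))‖ + ‖s • (z - x0)‖ := norm_add_le _ _
      _ ≤ _ := by
        rw [norm_smul, Real.norm_of_nonneg hs0]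
        have : s * ‖z - x0‖ ≤ 1 * ‖z - x0‖ := by gcongr; linarith
        linarith
  apply aux_HB hB u hρ hC
  intro v hv
  have h1s : 0 < 1 - s := by linarith
  set y := x0 + (1 - s)⁻¹ • (v - s • z' - (1 - s) • x0) with hy
  have hyx : ‖y - x0‖ < r := by
    rw [hy, add_sub_cancel_left, norm_smul, norm_inv, Real.norm_of_nonneg h1s.le,
      inv_mul_lt_iff₀ h1s]
    have e : v - s • z' - (1 - s) • x0 =
        (v - u) + (u - (x0 + s • (z - x0))) + s • (z - z') := by module
    rw [e]
    have n1 := norm_add₃_le (a := v - u) (b := u - (x0 + s • (z - x0))) (c := s • (z - z'))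
    have n2 : ‖s • (z - z')‖ ≤ ρ := by
      rw [norm_smul, Real.norm_of_nonneg hs0]
      nlinarith [norm_nonneg (z - z')]
    have n3 : (1 - t) * r ≤ (1 - s) * r := by gcongr
    have n4 : 4 * ρ = (1 - t) * r := by rw [hρdef]; ring
    linarith
  obtain ⟨ys, hys⟩ := hdom y hyx
  have hysM := hbd _ hys hyx
  refine ⟨_, hz', _, hys, s, hs0, by linarith, ?_, ?_⟩
  · simp only
    rw [hy, smul_add, smul_smul, mul_inv_cancel₀ h1s.ne', one_smul]
    abel
  · simp only
    have k1 : zs' (z' - u) ≤ (2 * ρ + 2 * D) * ‖zs'‖ := by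
      refine (le_abs_self _).trans ((zs'.le_opNorm _).trans ?_)
      rw [mul_comm]
      gcongr
      have e : z' - u = -(z - z') + (z - x0) + -(u - x0) := by abel
      rw [e]
      have n1 := norm_add₃_le (a := -(z - z')) (b := z - x0) (c := -(u - x0))
      rw [norm_neg, norm_neg] at n1
      linarith
    have k2 : ys (y - u) ≤ (r + ρ + D) * M := by
      refine (le_abs_self _).trans ((ys.le_opNorm _).trans ?_)
      rw [mul_comm]
      have e : y - u = (y - x0) - (u - x0) := by abel
      have n1 := norm_sub_le (y - x0) (u - x0)
      rw [← e] at n1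
      have : ‖y - u‖ ≤ r + ρ + D := by linarith
      gcongr
    have k3 : 0 ≤ (2 * ρ + 2 * D) * ‖zs'‖ := by positivity
    have k4 : 0 ≤ (r + ρ + D) * M := by positivity
    have k5 := mul_le_mul_of_nonneg_left k1 hs0
    have k6 := mul_le_mul_of_nonneg_left k2 h1s.le
    nlinarith

theorem aux_bound {X : Type*} [NormedAddCommGroup X] [NormedSpace ℝ X] (f : X →L[ℝ] ℝ) (x : X)
    {k d : ℝ} (hk : ‖f‖ ≤ k) (hd : ‖x‖ ≤ d) : |f x| ≤ k * d := by
  have := f.le_opNorm x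
  rw [Real.norm_eq_abs] at this
  exact this.trans (mul_le_mul hk hd (norm_nonneg _) ((norm_nonneg _).trans hk))

/-- The scaling trick. -/
theorem aux_scale {X : Type*} [NormedAddCommGroup X] [NormedSpace ℝ X] (f : X →L[ℝ] ℝ)
    {x0 z a : X} {t : ℝ} (ht0 : 0 < t) (ht : t < 1) (h : 0 ≤ f (a - x0)) :
    t⁻¹ * f (x0 + t • (z - x0) - a) ≤ f (z - a) := by
  rw [inv_mul_le_iff₀ ht0]
  have e : t • (z - a) = (x0 + t • (z - x0) - a) + (1 - t) • (a - x0) := by module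
  have e2 := congrArg f e
  rw [map_add, map_smul, map_smul, smul_eq_mul, smul_eq_mul] at e2
  have : 0 ≤ (1 - t) * f (a - x0) := mul_nonneg (by linarith) h
  linarith

set_option maxHeartbeats 1000000 in
/-- Fitzpatrick function bound for `z` in the closure of `dom B`. -/
theorem fitz_sum_ge_of_mem_closure_domB {X : Type*} [NormedAddCommGroup X] [NormedSpace ℝ X]
    [CompleteSpace X]
    (A B : Set (X × (X →L[ℝ] ℝ)))
    (hFPV : IsFPV A) (hB : IsMaxMonotoneOp B)
    (hdom : (opDom A ∩ interior (opDom B)).Nonempty) :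
    ∀ (z : X) (zs : X →L[ℝ] ℝ), z ∈ closure (opDom B) →
      ((zs z : ℝ) : EReal) ≤ fitz (opSum A B) (z, zs) := by
  intro z zs hz
  by_contra hlt
  push Not at hlt
  obtain ⟨c, hc1, hc2⟩ := EReal.lt_iff_exists_real_btwn.1 hlt
  have hc2' : c < zs z := by exact_mod_cast hc2
  set ε := zs z - c with hε
  have hεpos : 0 < ε := by linarith
  have H : ∀ a as bs, (a, as) ∈ A → (a, bs) ∈ B →
      ε ≤ zs (z - a) - as (z - a) - bs (z - a) := by
    intro a as bs ha hb
    have hm : (a, as + bs) ∈ opSum A B := ⟨as, bs, ha, hb, rfl⟩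
    have hle : (((as + bs) z + zs a - (as + bs) a : ℝ) : EReal) ≤ fitz (opSum A B) (z, zs) :=
      le_iSup₂_of_le (f := fun (q : X × (X →L[ℝ] ℝ)) (_ : q ∈ opSum A B) =>
        ((q.2 z + zs q.1 - q.2 q.1 : ℝ) : EReal)) (a, as + bs) hm le_rfl
    have hle2 : (as + bs) z + zs a - (as + bs) a < c := by
      exact_mod_cast hle.trans_lt hc1
    simp only [ContinuousLinearMap.add_apply, map_sub] at hle2 ⊢
    linarith
  obtain ⟨x0, ⟨a0, ha0⟩, hx0⟩ := hdom
  obtain ⟨b0, hb0⟩ := interior_subset hx0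
  set D := ‖z - x0‖ with hD
  have hD0 : 0 ≤ D := norm_nonneg _
  set c0 := ‖zs - a0 - b0‖ with hc0
  have hc00 : 0 ≤ c0 := norm_nonneg _
  -- choice of t
  obtain ⟨t, ht2, ht1, htε⟩ : ∃ t : ℝ, 1 / 2 ≤ t ∧ t < 1 ∧ c0 * ((1 - t) * D) < ε / 2 := by
    have hlim : Tendsto (fun t : ℝ => c0 * ((1 - t) * D)) (𝓝[<] 1) (𝓝 (c0 * ((1 - 1) * D))) :=
      (Continuous.tendsto (by fun_prop) 1).mono_left nhdsWithin_le_nhds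
    have h1 := hlim.eventually_lt_const (u := ε / 2) (by simp; linarith)
    have h2 : ∀ᶠ t : ℝ in 𝓝[<] 1, t ∈ Ico (1 / 2 : ℝ) 1 :=
      Ico_mem_nhdsLT (by norm_num)
    obtain ⟨t, h3, h4⟩ := (h1.and h2).exists
    exact ⟨t, h4.1, h4.2, h3⟩
  have ht0 : 0 < t := by linarith
  have htinv1 : 1 ≤ t⁻¹ := (one_le_inv₀ ht0).2 ht1.le
  have htinv2 : t⁻¹ ≤ 2 := by
    rw [inv_le_comm₀ ht0 (by norm_num)]; linarith
  obtain ⟨ρ, hρ, K, hK, htube⟩ := aux_tube hB hx0 hz ht1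
  set zt := x0 + t • (z - x0) with hzt
  by_cases hcl : zt ∈ closure (opDom A)
  · -- first case
    set L := c0 + 2 * (K + ‖b0‖) with hL
    have hL0 : 0 ≤ L := by positivity
    obtain ⟨δ, hδ, hδρ, hδL⟩ : ∃ δ > 0, δ ≤ ρ ∧ L * δ ≤ ε / 2 := by
      refine ⟨min ρ (ε / (2 * (L + 1))), lt_min hρ (by positivity), min_le_left _ _, ?_⟩
      calc L * min ρ (ε / (2 * (L + 1))) ≤ (L + 1) * (ε / (2 * (L + 1))) := by
            gcongr
            · linarith
            · exact min_le_right _ _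
        _ = ε / 2 := by field_simp
    obtain ⟨a, as, haA, had, hpos⟩ : ∃ a as, (a, as) ∈ A ∧ ‖a - zt‖ < δ ∧
        0 ≤ (as - a0) (zt - a) := by
      by_contra hcon
      push Not at hcon
      obtain ⟨y, hyA, hyd⟩ := Metric.mem_closure_iff.1 hcl δ hδ
      have hmem : (zt, a0) ∈ A := by
        refine hFPV.2 (Metric.ball zt δ) Metric.isOpen_ball (convex_ball _ _)
          ⟨y, by rwa [Metric.mem_ball, dist_comm], hyA⟩ zt a0 (Metric.mem_ball_self hδ) ?_
        rintro ⟨a, as⟩ ⟨ha, ha2, -⟩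
        have hd : ‖a - zt‖ < δ := by
          simpa only [Metric.mem_ball, dist_eq_norm] using ha2
        have := hcon a as ha hd
        simp only [ContinuousLinearMap.sub_apply] at this ⊢
        linarith
      have := hcon zt a0 hmem (by simpa using hδ)
      simp at this
    obtain ⟨bs, hbs, hbK⟩ := htube t ht0.le le_rfl a (had.trans_le hδρ)
    have e1 := aux_scale (as - a0) (z := z) ht0 ht1 (hFPV.1.1 _ haA _ ha0)
    have e2 := aux_scale (bs - b0) (z := z) ht0 ht1 (hB.1 _ hbs _ hb0)
    have e1' : 0 ≤ (as - a0) (z - a) := le_trans (by positivity) e1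
    have hd' : ‖zt - a‖ ≤ δ := by rw [norm_sub_rev]; exact had.le
    have e3 := aux_bound (bs - b0) (zt - a) ((norm_sub_le bs b0).trans
      (add_le_add_left hbK _)) hd'
    have e4 : -(2 * ((K + ‖b0‖) * δ)) ≤ (bs - b0) (z - a) := by
      have f1 := (abs_le.1 e3).1
      have f2 : 0 ≤ (K + ‖b0‖) * δ := by positivity
      have f3 : t⁻¹ * (-((K + ‖b0‖) * δ)) ≤ t⁻¹ * (bs - b0) (zt - a) := by gcongr
      nlinarith
    have hza : ‖z - a‖ ≤ (1 - t) * D + δ := by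
      have e : z - a = (1 - t) • (z - x0) + (zt - a) := by rw [hzt]; module
      rw [e]
      refine (norm_add_le _ _).trans ?_
      rw [norm_smul, Real.norm_of_nonneg (by linarith)]
      linarith
    have e5 := (abs_le.1 (aux_bound (zs - a0 - b0) (z - a) le_rfl hza)).2
    have e6 := H a as bs haA hbs
    rw [← hc0] at e5
    simp only [ContinuousLinearMap.sub_apply] at e1' e4 e5
    have e7 : L * δ = c0 * δ + 2 * ((K + ‖b0‖) * δ) := by rw [hL]; ring
    linarith
  · -- second case
    obtain ⟨r, hr, hrA⟩ : ∃ r > 0, ∀ a ∈ opDom A, r ≤ ‖zt - a‖ := by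
      rw [Metric.mem_closure_iff] at hcl
      push Not at hcl
      obtain ⟨r, hr, h⟩ := hcl
      exact ⟨r, hr, fun a ha => by rw [← dist_eq_norm]; exact h a ha⟩
    set δ := min ρ (r / 4) with hδdef
    have hδ : 0 < δ := lt_min hρ (by positivity)
    have hδρ : δ ≤ ρ := min_le_left _ _
    have hδr : δ ≤ r / 4 := min_le_right _ _
    obtain ⟨j, hj1, hj2⟩ := exists_dual_vector'' ℝ (z - x0)
    have hj2' : j (z - x0) = D := by simpa using hj2
    set G := (‖zs - a0‖ + K) * (D + ρ) with hG
    have hG0 : 0 ≤ G := by positivity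
    set n := 2 * G / r with hn
    have hn0 : 0 ≤ n := by positivity
    have hnr : n * (r / 2) = G := by rw [hn]; field_simp
    have hnot : (zt, a0 + n • j) ∉ A := fun hmem => hcl (subset_closure ⟨_, hmem⟩)
    have hex : ∃ a as, (a, as) ∈ A ∧ a ∈ Metric.thickening δ (segment ℝ x0 zt) ∧
        (a0 + n • j - as) (zt - a) < 0 := by
      by_contra hcon
      push Not at hcon
      refine hnot (hFPV.2 (Metric.thickening δ (segment ℝ x0 zt)) Metric.isOpen_thickening
        ((convex_segment x0 zt).thickening δ)
        ⟨x0, Metric.self_subset_thickening hδ _ (left_mem_segment ℝ x0 zt), ⟨a0, ha0⟩⟩ zt _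
        (Metric.self_subset_thickening hδ _ (right_mem_segment ℝ x0 zt)) ?_)
      rintro ⟨a, as⟩ ⟨ha, ha2, -⟩
      exact hcon a as ha ha2
    obtain ⟨a, as, haA, haU, hneg⟩ := hex
    obtain ⟨y, hy, hya⟩ := Metric.mem_thickening_iff.1 haU
    rw [segment_eq_image'] at hy
    obtain ⟨θ, ⟨hθ0, hθ1⟩, rfl⟩ := hy
    rw [dist_eq_norm] at hya
    have hs0 : 0 ≤ θ * t := by positivity
    have hst : θ * t ≤ t := by nlinarith
    set s := θ * t with hs
    have hy' : x0 + θ • (zt - x0) = x0 + s • (z - x0) := by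
      rw [hzt, add_sub_cancel_left, smul_smul]
    simp only [hy'] at hya
    obtain ⟨bs, hbs, hbK⟩ := htube s hs0 hst a (hya.trans_le hδρ)
    have hra := hrA a ⟨as, haA⟩
    have hdec : zt - a = (t - s) • (z - x0) - (a - (x0 + s • (z - x0))) := by
      rw [hzt]; module
    have hjl : r / 2 ≤ j (zt - a) := by
      have f1 : ‖zt - a‖ ≤ (t - s) * D + δ := by
        rw [hdec]
        refine (norm_sub_le _ _).trans ?_
        rw [norm_smul, Real.norm_of_nonneg (by linarith)]
        linarith
      have f2 := (abs_le.1 (aux_bound j (a - (x0 + s • (z - x0))) hj1 hya.le)).2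
      rw [hdec, map_sub, map_smul, smul_eq_mul, hj2']
      linarith
    have e1 := aux_scale (as - a0) (z := z) ht0 ht1 (hFPV.1.1 _ haA _ ha0)
    have e2 : G < (as - a0) (zt - a) := by
      have f1 : n * (r / 2) ≤ n * j (zt - a) := by gcongr
      simp only [ContinuousLinearMap.sub_apply, ContinuousLinearMap.add_apply,
        ContinuousLinearMap.smul_apply, smul_eq_mul] at hneg ⊢
      linarith
    have e3 : G < (as - a0) (z - a) := by nlinarith
    have hza : ‖z - a‖ ≤ D + ρ := by
      have e : z - a = (1 - s) • (z - x0) - (a - (x0 + s • (z - x0))) := by module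
      rw [e]
      refine (norm_sub_le _ _).trans ?_
      rw [norm_smul, Real.norm_of_nonneg (by linarith)]
      have f1 : (1 - s) * D ≤ 1 * D := mul_le_mul_of_nonneg_right (by linarith) hD0
      linarith
    have e4 := (abs_le.1 (aux_bound (zs - a0) (z - a) le_rfl hza)).2
    have e5 := (abs_le.1 (aux_bound bs (z - a) hbK hza)).1
    have e6 := H a as bs haA hbs
    have e7 : G = ‖zs - a0‖ * (D + ρ) + K * (D + ρ) := by rw [hG]; ring
    simp only [ContinuousLinearMap.sub_apply] at e3 e4
    linarith
end
end

section
/- Let X be a real Banach space, let A : X ⇉ X* be of type (FPV), and let B : X ⇉ X* be maximally monotone. Suppose star(dom A) ∩ int(dom B) ≠ ∅ and that (z, z*) ∈ X × X* satisfies F_{A+B}(z, z*) < +∞. Then z lies in the norm closure of dom A. -/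
open Set Filter Topology

noncomputable section

variable {X : Type*} [NormedAddCommGroup X] [NormedSpace ℝ X]

/-- Membership by maximality. -/
theorem max_mem {A : Set (X × (X →L[ℝ] ℝ))} (hA : IsMaxMonotoneOp A) (x : X) (xs : X →L[ℝ] ℝ)
    (h : ∀ y ys, (y, ys) ∈ A → 0 ≤ (xs - ys) (x - y)) : (x, xs) ∈ A := by
  have h1 : IsMonotoneOp (insert (x, xs) A) := by
    rintro ⟨u, us⟩ hu ⟨v, vs⟩ hv
    rcases hu with hu | hu <;> rcases hv with hv | hv
    · simp only [Prod.mk.injEq] at hu hv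
      obtain ⟨rfl, rfl⟩ := hu
      obtain ⟨rfl, rfl⟩ := hv
      simp
    · simp only [Prod.mk.injEq] at hu
      obtain ⟨rfl, rfl⟩ := hu
      exact h v vs hv
    · simp only [Prod.mk.injEq] at hv
      obtain ⟨rfl, rfl⟩ := hv
      have := h u us hu
      simp only [_root_.sub_apply, map_sub] at this ⊢
      linarith
    · exact hA.1 _ hu _ hv
  have h2 := hA.2 _ h1 (subset_insert _ _)
  rw [← h2]
  exact mem_insert _ _

/-- Local boundedness on the interior of the domain. -/
theorem loc_bdd [CompleteSpace X] {B : Set (X × (X →L[ℝ] ℝ))} (hB : IsMonotoneOp B) {p : X}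
    (hp : p ∈ interior (opDom B)) :
    ∃ δ > 0, ∃ M > 0, Metric.ball p δ ⊆ opDom B ∧
      ∀ y ys, (y, ys) ∈ B → y ∈ Metric.ball p δ → ‖ys‖ ≤ M := by
  obtain ⟨r, hr, hrB⟩ := Metric.mem_nhds_iff.1 (mem_interior_iff_mem_nhds.1 hp)
  let ι := {q : X × (X →L[ℝ] ℝ) // q ∈ B ∧ ‖q.1 - p‖ ≤ 1}
  let g : ι → X →L[ℝ] ℝ := fun q => (1 + ‖q.1.2‖ * ‖q.1.1 - p‖)⁻¹ • q.1.2
  have hone : ∀ v : X, ‖v‖ < r → ∃ C ≥ 0, ∀ i : ι, i.1.2 v ≤ C * (1 + ‖i.1.2‖ * ‖i.1.1 - p‖) := by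
    intro v hv
    have : p + v ∈ opDom B := hrB (by simpa using hv)
    obtain ⟨w, hw⟩ := this
    refine ⟨‖w‖ * (1 + ‖v‖) + 1, by positivity, ?_⟩
    rintro ⟨⟨y, ys⟩, hy, hy1⟩
    have h1 := hB _ hw _ hy
    have h2 : ys v ≤ w (p + v - y) + ys (y - p) := by
      simp only [_root_.sub_apply, map_sub, map_add] at h1 ⊢
      linarith
    have h3 : w (p + v - y) ≤ ‖w‖ * (1 + ‖v‖) := by
      refine (le_abs_self _).trans ((w.le_opNorm _).trans ?_)
      gcongr
      have : p + v - y = v - (y - p) := by abel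
      rw [this]
      refine (norm_sub_le _ _).trans ?_
      simp only at hy1
      linarith
    have h4 : ys (y - p) ≤ ‖ys‖ * ‖y - p‖ := (le_abs_self _).trans (ys.le_opNorm _)
    simp only
    have h5 : 0 ≤ ‖ys‖ * ‖y - p‖ := by positivity
    have h6 : 0 ≤ ‖w‖ * (1 + ‖v‖) := by positivity
    nlinarith [mul_nonneg h6 h5]
  have hbs : ∀ v : X, ∃ C, ∀ i : ι, ‖g i v‖ ≤ C := by
    intro v
    let s : ℝ := r / (2 * (‖v‖ + 1))
    have hs : 0 < s := by positivity
    have hsv : ‖s • v‖ < r := by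
      rw [norm_smul, Real.norm_of_nonneg hs.le]
      have : s * (‖v‖ + 1) = r / 2 := by simp only [s]; field_simp
      nlinarith [norm_nonneg v]
    obtain ⟨C1, hC1, h1⟩ := hone (s • v) hsv
    obtain ⟨C2, hC2, h2⟩ := hone (-(s • v)) (by simpa using hsv)
    refine ⟨(C1 + C2) / s, fun i => ?_⟩
    have e1 := h1 i
    have e2 := h2 i
    have hD : 0 < 1 + ‖i.1.2‖ * ‖i.1.1 - p‖ := by positivity
    simp only [g, _root_.smul_apply, norm_smul, norm_inv, Real.norm_eq_abs]
    rw [abs_of_pos hD, inv_mul_le_iff₀ hD, abs_le]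
    simp only [map_neg, map_smul, smul_eq_mul] at e1 e2
    have e3 : (1 + ‖i.1.2‖ * ‖i.1.1 - p‖) * ((C1 + C2) / s) =
      ((C1 + C2) * (1 + ‖i.1.2‖ * ‖i.1.1 - p‖)) / s := by ring
    rw [e3]
    constructor
    · rw [neg_le, le_div_iff₀ hs]
      nlinarith [mul_nonneg hC1 hD.le]
    · rw [le_div_iff₀ hs]
      nlinarith [mul_nonneg hC2 hD.le]
  obtain ⟨K, hK⟩ := banach_steinhaus hbs
  set K' := max K 1 with hK'
  have hK1 : 1 ≤ K' := le_max_right _ _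
  refine ⟨min r (1 / (2 * K')), by positivity, 2 * K', by positivity, ?_, ?_⟩
  · exact (Metric.ball_subset_ball (min_le_left _ _)).trans hrB
  · intro y ys hy hyp
    have hd : ‖y - p‖ < 1 / (2 * K') := by
      rw [Metric.mem_ball, dist_eq_norm] at hyp
      exact hyp.trans_le (min_le_right _ _)
    have hd1 : ‖y - p‖ * (2 * K') < 1 := by rwa [lt_div_iff₀ (by positivity)] at hd
    have h1 := (hK ⟨(y, ys), hy, by
      simp only
      nlinarith [norm_nonneg (y - p)]⟩).trans (le_max_left K 1)
    have hD : 0 < 1 + ‖ys‖ * ‖y - p‖ := by positivity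
    simp only [g, norm_smul, norm_inv, Real.norm_eq_abs] at h1
    rw [abs_of_pos hD, inv_mul_le_iff₀ hD, ← hK'] at h1
    nlinarith [norm_nonneg ys, norm_nonneg (y - p), mul_nonneg (norm_nonneg ys) (norm_nonneg (y-p))]

/-- Rockafellar: the interior of the convex hull of the domain lies in the domain. -/
theorem int_hull_sub {B : Set (X × (X →L[ℝ] ℝ))} (hB : IsMaxMonotoneOp B) {p : X} {δ M : ℝ}
    (hδ : 0 < δ) (hdom : Metric.ball p δ ⊆ opDom B)
    (hM : ∀ y ys, (y, ys) ∈ B → y ∈ Metric.ball p δ → ‖ys‖ ≤ M) :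
    interior (convexHull ℝ (opDom B)) ⊆ opDom B := by
  intro x hx
  let G : Set (X × (X →L[ℝ] ℝ) × ℝ) := {t | (t.1, t.2.1) ∈ B ∧ t.2.2 = t.2.1 t.1}
  let K := convexHull ℝ G
  have key1 : ∀ y ys, (y, ys) ∈ B → ∀ t ∈ K, t.2.1 y + ys t.1 - ys y ≤ t.2.2 := by
    intro y ys hy
    have hc : Convex ℝ {t : X × (X →L[ℝ] ℝ) × ℝ | t.2.1 y + ys t.1 - ys y ≤ t.2.2} := by
      rintro ⟨u, us, s⟩ hu ⟨v, vs, t⟩ hv a b ha hb hab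
      simp only [mem_ofPred_eq, Prod.fst_add, Prod.snd_add, Prod.smul_fst, Prod.smul_snd,
        _root_.add_apply, _root_.smul_apply, map_add, map_smul,
        smul_eq_mul] at hu hv ⊢
      obtain rfl : b = 1 - a := by linarith
      nlinarith
    refine fun t ht => convexHull_min ?_ hc ht
    rintro ⟨u, us, s⟩ ⟨h1, h2⟩
    have := hB.1 _ h1 _ hy
    simp only [mem_ofPred_eq, _root_.sub_apply, map_sub] at this h2 ⊢
    linarith
  have key2 : ∀ q ∈ K, ∀ t ∈ K, t.2.1 q.1 + q.2.1 t.1 - t.2.2 ≤ q.2.2 := by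
    rintro ⟨y, ys, r⟩ hq
    have hc : Convex ℝ {t : X × (X →L[ℝ] ℝ) × ℝ | t.2.1 y + ys t.1 - t.2.2 ≤ r} := by
      rintro ⟨u, us, s⟩ hu ⟨v, vs, t⟩ hv a b ha hb hab
      simp only [mem_ofPred_eq, Prod.fst_add, Prod.snd_add, Prod.smul_fst, Prod.smul_snd,
        _root_.add_apply, _root_.smul_apply, map_add, map_smul,
        smul_eq_mul] at hu hv ⊢
      obtain rfl : b = 1 - a := by linarith
      nlinarith
    refine fun t ht => convexHull_min ?_ hc ht
    rintro ⟨u, us, s⟩ ⟨h1, h2⟩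
    have := key1 u us h1 _ hq
    simp only [mem_ofPred_eq] at this h2 ⊢
    linarith
  let H : Set (X × ℝ) := {w | ∃ us s, (w.1, us, s) ∈ K ∧ w.2 ≤ us x - s}
  have hHc : Convex ℝ H := by
    rintro ⟨u, r⟩ ⟨us, s, h1, h2⟩ ⟨v, r'⟩ ⟨vs, t, h3, h4⟩ a b ha hb hab
    refine ⟨a • us + b • vs, a • s + b • t, ?_, ?_⟩
    · exact (convex_convexHull ℝ G) h1 h3 ha hb hab
    · simp only [Prod.snd_add, Prod.smul_snd,
        _root_.add_apply, _root_.smul_apply, smul_eq_mul] at h2 h4 ⊢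
      nlinarith
  have hHx : ∀ r, (x, r) ∈ H → r ≤ 0 := by
    rintro r ⟨us, s, h1, h2⟩
    have := key2 _ h1 _ h1
    simp only at this h2
    linarith
  have hBH : ∀ y ys r, (y, ys) ∈ B → r ≤ ys (x - y) → (y, r) ∈ H := by
    intro y ys r hy hr
    refine ⟨ys, ys y, subset_convexHull ℝ G ⟨hy, rfl⟩, ?_⟩
    simpa using hr
  let M' : ℝ := M * (‖x - p‖ + δ)
  have hball : Metric.ball p δ ×ˢ Iio (-M') ⊆ H := by
    rintro ⟨y, r⟩ ⟨hy, hr⟩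
    obtain ⟨ys, hys⟩ := hdom hy
    refine hBH y ys r hys ?_
    have h1 := hM y ys hys hy
    have h2 : |ys (x - y)| ≤ M' := by
      refine (ys.le_opNorm _).trans ?_
      have : ‖x - y‖ ≤ ‖x - p‖ + δ := by
        have e : x - y = (x - p) + (p - y) := by abel
        rw [e]
        refine (norm_add_le _ _).trans ?_
        have : ‖p - y‖ < δ := by rw [← dist_eq_norm, dist_comm]; exact hy
        linarith
      have h0 := (norm_nonneg ys).trans h1
      simp only [M']
      gcongr
    have := (abs_le.1 h2).1
    simp only [mem_Iio] at hr
    linarith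
  have hopen : IsOpen (Metric.ball p δ ×ˢ Iio (-M')) := Metric.isOpen_ball.prod isOpen_Iio
  have hint : ((p, -M' - 1) : X × ℝ) ∈ interior H :=
    interior_maximal hball hopen ⟨Metric.mem_ball_self hδ, by simp⟩
  have hnot : ((x, 0) : X × ℝ) ∉ interior H := by
    intro h
    have hc : Tendsto (fun r : ℝ => ((x, r) : X × ℝ)) (𝓝[>] 0) (𝓝 (x, 0)) :=
      (Continuous.tendsto (by fun_prop) 0).mono_left nhdsWithin_le_nhds
    have h1 := hc (mem_interior_iff_mem_nhds.1 h)
    obtain ⟨r, hr, hr0⟩ := (Filter.Eventually.and (show ∀ᶠ r in 𝓝[>] (0:ℝ), (x, r) ∈ H from h1)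
      self_mem_nhdsWithin).exists
    exact absurd (hHx r hr) (not_le.2 hr0)
  obtain ⟨f, hf⟩ := geometric_hahn_banach_open_point hHc.interior isOpen_interior hnot
  have hf' : ∀ w ∈ H, f w ≤ f (x, 0) := by
    intro w hw
    have h1 : w ∈ closure (interior H) := by
      rw [hHc.closure_interior_eq_closure_of_nonempty_interior ⟨_, hint⟩]
      exact subset_closure hw
    have : closure (interior H) ⊆ {w | f w ≤ f (x, 0)} :=
      closure_minimal (fun w hw => (hf w hw).le) (isClosed_le f.continuous continuous_const)
    exact this h1
  let g : X →L[ℝ] ℝ := f.comp (ContinuousLinearMap.inl ℝ X ℝ)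
  let c : ℝ := f (0, 1)
  have hfg : ∀ u r, f (u, r) = g u + r * c := by
    intro u r
    have : ((u, r) : X × ℝ) = (u, 0) + r • (0, 1) := by simp
    rw [this, map_add, map_smul]
    simp [g, c]
  have hineq : ∀ y ys r, (y, ys) ∈ B → r ≤ ys (x - y) → g y + r * c ≤ g x := by
    intro y ys r hy hr
    have := hf' _ (hBH y ys r hy hr)
    rw [hfg, hfg] at this
    linarith
  obtain ⟨ps, hps⟩ := hdom (Metric.mem_ball_self hδ)
  have hc0 : 0 ≤ c := by
    by_contra hneg
    push Not at hneg
    let r := min (ps (x - p)) ((g x - g p + 1) / c)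
    have h1 := hineq p ps r hps (min_le_left _ _)
    have h2 : r ≤ (g x - g p + 1) / c := min_le_right _ _
    rw [le_div_iff_of_neg hneg] at h2
    linarith
  rcases hc0.eq_or_lt with hc | hc
  · exfalso
    have hle : convexHull ℝ (opDom B) ⊆ {y | g y ≤ g x} := by
      refine convexHull_min ?_ (convex_halfSpace_le g.isLinear _)
      rintro y ⟨ys, hy⟩
      have := hineq y ys _ hy le_rfl
      rw [← hc] at this
      simpa using this
    have hmax : IsLocalMax g x := by
      filter_upwards [mem_interior_iff_mem_nhds.1 hx] with y hy using hle hy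
    have hg0 := hmax.hasFDerivAt_eq_zero g.hasFDerivAt
    have := hf _ hint
    rw [hfg, hfg, hg0, ← hc] at this
    simp at this
  · refine ⟨c⁻¹ • g, max_mem hB _ _ ?_⟩
    intro y ys hy
    have := hineq y ys _ hy le_rfl
    have h2 : ys (x - y) ≤ c⁻¹ * (g x - g y) := by
      rw [← div_eq_inv_mul, le_div_iff₀ hc]
      linarith
    simp only [_root_.sub_apply, _root_.smul_apply, smul_eq_mul] 
    rw [map_sub g]
    linarith

/-- Closedness of bounded parts of a maximally monotone graph. -/
theorem bdd_limit {B : Set (X × (X →L[ℝ] ℝ))} (hB : IsMaxMonotoneOp B) {q : X} {R : ℝ}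
    (a : ℕ → X) (b : ℕ → X →L[ℝ] ℝ) (hab : ∀ n, (a n, b n) ∈ B) (ha : Tendsto a atTop (𝓝 q))
    (hb : ∀ n, ‖b n‖ ≤ R) : q ∈ opDom B := by
  let b' : ℕ → WeakDual ℝ X := fun n => StrongDual.toWeakDual (b n)
  have hK := WeakDual.isCompact_closedBall (𝕜 := ℝ) (E := X) 0 R
  let 𝒰 : Ultrafilter ℕ := Ultrafilter.of atTop
  have hU : (𝒰 : Filter ℕ) ≤ atTop := Ultrafilter.of_le _
  obtain ⟨w, -, hw⟩ := hK.ultrafilter_le_nhds (𝒰.map b') (by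
    simp only [Ultrafilter.coe_map, le_principal_iff, mem_map]
    refine univ_mem' fun n => ?_
    simp only [mem_preimage, mem_closedBall_zero_iff, b']
    simpa using hb n)
  have hev : ∀ y, Tendsto (fun n => b n y) 𝒰 (𝓝 (WeakDual.toStrongDual w y)) := by
    intro y
    exact ((WeakDual.eval_continuous y).tendsto w).comp (show Tendsto b' 𝒰 (𝓝 w) from hw)
  refine ⟨WeakDual.toStrongDual w, max_mem hB _ _ ?_⟩
  intro y ys hy
  have ha' : Tendsto a 𝒰 (𝓝 q) := ha.mono_left hU
  have h0 : Tendsto (fun n => b n (a n - q)) 𝒰 (𝓝 0) := by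
    have h1 : Tendsto (fun n => R * ‖a n - q‖) 𝒰 (𝓝 0) := by
      have := (tendsto_iff_norm_sub_tendsto_zero.1 ha').const_mul R
      simpa using this
    refine squeeze_zero_norm (fun n => ?_) h1
    exact ((b n).le_opNorm _).trans (by gcongr; exact hb n)
  have h1 : Tendsto (fun n => (b n (q - y) + b n (a n - q)) - ys (a n - y)) 𝒰
      (𝓝 ((WeakDual.toStrongDual w (q - y) + 0) - ys (q - y))) := by
    refine ((hev _).add h0).sub ?_
    exact (ys.continuous.tendsto _).comp (ha'.sub_const y)
  have h2 := ge_of_tendsto' h1 (b := 0) (fun n => by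
    have := hB.1 _ (hab n) _ hy
    simp only [_root_.sub_apply, map_sub] at this ⊢
    linarith)
  simpa using h2

theorem norm_le_of_ball (b : X →L[ℝ] ℝ) {ρ C : ℝ} (hρ : 0 < ρ)
    (h : ∀ v, ‖v‖ ≤ ρ → b v ≤ C) : ‖b‖ ≤ C / ρ := by
  have hC : 0 ≤ C := by simpa using h 0 (by simpa using hρ.le)
  have h1 : ∀ u, b u ≤ C / ρ * ‖u‖ := by
    intro u
    rcases eq_or_ne u 0 with rfl | hu
    · simp
    have hu' : 0 < ‖u‖ := norm_pos_iff.2 hu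
    have h2 := h ((ρ / ‖u‖) • u) (by
      rw [norm_smul, Real.norm_of_nonneg (by positivity)]
      field_simp
      exact le_rfl)
    rw [map_smul, smul_eq_mul, div_mul_eq_mul_div, div_le_iff₀ hu'] at h2
    rw [div_mul_eq_mul_div, le_div_iff₀ hρ]
    linarith
  refine b.opNorm_le_bound (by positivity) fun u => ?_
  rw [Real.norm_eq_abs, abs_le]
  have h2 := h1 (-u)
  rw [map_neg, norm_neg] at h2
  exact ⟨by linarith, h1 u⟩

/-- Points of the graph near the segment with large values. -/
theorem find_a {A : Set (X × (X →L[ℝ] ℝ))} (hA : IsFPV A) {p z : X} {d : ℝ} (hd : 0 < d)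
    (hp : p ∈ opDom A) (hz : ∀ a ∈ opDom A, d ≤ ‖z - a‖) (ε N : ℝ) (hε : 0 < ε) (hεd : ε ≤ d / 4)
    (hN : 0 ≤ N) :
    ∃ a as l e, (a, as) ∈ A ∧ 0 ≤ l ∧ l ≤ 1 ∧ a = p + l • (z - p) + e ∧ ‖e‖ < ε ∧
      N ≤ as (z - a) ∧ d / 2 ≤ (1 - l) * ‖z - p‖ := by
  obtain ⟨g, hg1, hg2⟩ := exists_dual_vector'' ℝ (z - p)
  have hg2 : g (z - p) = ‖z - p‖ := by simpa using hg2
  let U := Metric.thickening ε (segment ℝ p z)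
  have hUo : IsOpen U := Metric.isOpen_thickening
  have hUc : Convex ℝ U := (convex_segment p z).thickening ε
  have hsub : segment ℝ p z ⊆ U := Metric.self_subset_thickening hε _
  have hzA : (z, (2 * N / d) • g) ∉ A := by
    intro h
    have := hz z ⟨_, h⟩
    simp at this
    linarith
  have hnr : ¬ MonotonicallyRelated (A ∩ (U ×ˢ (univ : Set (X →L[ℝ] ℝ)))) (z, (2 * N / d) • g) :=
    fun h => hzA (hA.2 U hUo hUc ⟨p, hsub (left_mem_segment ℝ p z), hp⟩ z _
      (hsub (right_mem_segment ℝ p z)) h)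
  unfold MonotonicallyRelated at hnr
  push Not at hnr
  obtain ⟨⟨a, as⟩, ⟨haA, haU, -⟩, hlt⟩ := hnr
  obtain ⟨w, hw, haw⟩ := Metric.mem_thickening_iff.1 haU
  rw [segment_eq_image'] at hw
  obtain ⟨l, ⟨hl0, hl1⟩, rfl⟩ := hw
  simp only at haw hlt
  set e := a - (p + l • (z - p)) with he
  have hen : ‖e‖ < ε := by rw [dist_eq_norm] at haw; exact haw
  have hae : a = p + l • (z - p) + e := by rw [he]; abel
  have hza : z - a = (1 - l) • (z - p) - e := by rw [he]; module
  have hda := hz a ⟨as, haA⟩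
  have h1 : d ≤ (1 - l) * ‖z - p‖ + ε := by
    rw [hza] at hda
    refine hda.trans ((norm_sub_le _ _).trans ?_)
    rw [norm_smul, Real.norm_of_nonneg (by linarith)]
    linarith
  refine ⟨a, as, l, e, haA, hl0, hl1, hae, hen, ?_, by linarith⟩
  have h2 : d / 2 ≤ g (z - a) := by
    rw [hza, map_sub, map_smul, hg2, smul_eq_mul]
    have : |g e| ≤ ε := (g.le_opNorm e).trans (by nlinarith [norm_nonneg e, norm_nonneg g])
    have := (abs_le.1 this).2
    linarith
  rw [_root_.sub_apply, _root_.smul_apply, smul_eq_mul] at hlt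
  have h3 : N = 2 * N / d * (d / 2) := by field_simp
  have h4 : 2 * N / d * (d / 2) ≤ 2 * N / d * g (z - a) := by gcongr
  linarith

/-- Points of the graph in a cone over `q`, with values bounded below. -/
theorem find_b {A : Set (X × (X →L[ℝ] ℝ))} (hA : IsFPV A) {p z q : X} {ps qs : X →L[ℝ] ℝ}
    {δ γ : ℝ} (hδ : 0 < δ) (hγ : 0 < γ) (hγ1 : γ < 1) (hγδ : γ * ‖z - p‖ < δ)
    (hp : (p, ps) ∈ A) (hq : (q, qs) ∈ A) (hseg : segment ℝ p q ⊆ opDom A)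
    (θ : ℝ) (hθ : 0 < θ) (hθ1 : θ < 1) :
    ∃ a as y, (a, as) ∈ A ∧ y ∈ Metric.ball p δ ∧ a = (1 - θ) • q + θ • y ∧
      -(γ⁻¹ * ((‖qs‖ + ‖ps‖) * (‖p - q‖ + δ))) ≤ as (z - a) := by
  let c := (1 - θ) • q + θ • p
  let U := Metric.ball c (θ * δ)
  let x := (1 - θ) • q + θ • (p + γ • (z - p))
  have hcA : c ∈ opDom A := hseg ⟨θ, 1 - θ, hθ.le, by linarith, by ring, by simp only [c]; abel⟩
  have hcU : c ∈ U := Metric.mem_ball_self (by positivity)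
  have hxU : x ∈ U := by
    have : x - c = (θ * γ) • (z - p) := by simp only [x, c]; module
    rw [Metric.mem_ball, dist_eq_norm, this, norm_smul, Real.norm_of_nonneg (by positivity)]
    nlinarith
  obtain ⟨a, as, haA, haU, ha⟩ : ∃ a as, (a, as) ∈ A ∧ a ∈ U ∧ 0 ≤ as (x - a) := by
    by_cases h : MonotonicallyRelated (A ∩ (U ×ˢ (univ : Set (X →L[ℝ] ℝ)))) (x, 0)
    · have := hA.2 U Metric.isOpen_ball (convex_ball _ _) ⟨c, hcU, hcA⟩ x 0 hxU h
      exact ⟨x, 0, this, hxU, by simp⟩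
    · unfold MonotonicallyRelated at h
      push Not at h
      obtain ⟨⟨a, as⟩, ⟨haA, haU, -⟩, hlt⟩ := h
      refine ⟨a, as, haA, haU, ?_⟩
      simp only [zero_sub, neg_apply] at hlt
      linarith
  have hac : ‖a - c‖ < θ * δ := by rw [← dist_eq_norm]; exact haU
  let y := p + θ⁻¹ • (a - c)
  have hay : a = (1 - θ) • q + θ • y := by
    simp only [y, smul_add, smul_smul, mul_inv_cancel₀ hθ.ne', one_smul, c]
    abel
  have hyb : ‖y - p‖ < δ := by
    simp only [y, add_sub_cancel_left, norm_smul, norm_inv, Real.norm_of_nonneg hθ.le]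
    rwa [inv_mul_lt_iff₀ hθ]
  refine ⟨a, as, y, haA, by rw [Metric.mem_ball, dist_eq_norm]; exact hyb, hay, ?_⟩
  have hdec : (θ * γ) • (z - a) = (x - a) + (1 - θ) • (a - q) + (θ * (1 - γ)) • (a - p) := by
    simp only [x]; module
  have m1 := hA.1.1 _ haA _ hq
  have m2 := hA.1.1 _ haA _ hp
  rw [_root_.sub_apply] at m1 m2
  simp only at m1 m2
  have hyq : ‖y - q‖ ≤ ‖p - q‖ + δ := by
    have : y - q = (y - p) + (p - q) := by abel
    rw [this]
    exact (norm_add_le _ _).trans (by linarith)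
  have n1 : ‖a - q‖ ≤ θ * (‖p - q‖ + δ) := by
    have : a - q = θ • (y - q) := by rw [hay]; module
    rw [this, norm_smul, Real.norm_of_nonneg hθ.le]
    gcongr
  have n2 : ‖a - p‖ ≤ ‖p - q‖ + δ := by
    have : a - p = (1 - θ) • (q - p) + θ • (y - p) := by rw [hay]; module
    rw [this]
    refine (norm_add_le _ _).trans ?_
    rw [norm_smul, norm_smul, Real.norm_of_nonneg hθ.le,
      Real.norm_of_nonneg (show 0 ≤ 1 - θ by linarith), norm_sub_rev q p]
    nlinarith [norm_nonneg (p - q)]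
  have k1 : -(‖qs‖ * (θ * (‖p - q‖ + δ))) ≤ as (a - q) := by
    have : |qs (a - q)| ≤ ‖qs‖ * (θ * (‖p - q‖ + δ)) := (qs.le_opNorm _).trans (by gcongr)
    linarith [(abs_le.1 this).1]
  have k2 : -(‖ps‖ * (‖p - q‖ + δ)) ≤ as (a - p) := by
    have : |ps (a - p)| ≤ ‖ps‖ * (‖p - q‖ + δ) := (ps.le_opNorm _).trans (by gcongr)
    linarith [(abs_le.1 this).1]
  have hdec' := congrArg as hdec
  simp only [map_add, map_smul, smul_eq_mul] at hdec'
  set D := ‖p - q‖ + δ with hD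
  have hD0 : 0 ≤ D := by positivity
  have hQ : 0 ≤ ‖qs‖ * D := by positivity
  have hP : 0 ≤ ‖ps‖ * D := by positivity
  have j1 : -(θ * (‖qs‖ * D)) ≤ (1 - θ) * as (a - q) := by
    have := mul_le_mul_of_nonneg_left k1 (show 0 ≤ 1 - θ by linarith)
    nlinarith [mul_nonneg hθ.le (mul_nonneg hθ.le hQ)]
  have j2 : -(θ * (‖ps‖ * D)) ≤ θ * (1 - γ) * as (a - p) := by
    have := mul_le_mul_of_nonneg_left k2 (show 0 ≤ θ * (1 - γ) by
      exact mul_nonneg hθ.le (by linarith))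
    nlinarith [mul_nonneg (mul_nonneg hθ.le hγ.le) hP]
  have j3 : θ * (-((‖qs‖ + ‖ps‖) * D)) ≤ θ * (γ * as (z - a)) := by
    nlinarith
  have j4 := le_of_mul_le_mul_left j3 hθ
  rw [neg_le, ← mul_neg, ← div_eq_inv_mul, le_div_iff₀ hγ] at *
  linarith

theorem cone_eq {p z e : X} {l : ℝ} (hl : 0 < l) (hl1 : l < 1) :
    z - (p + l • (z - p) + e) =
      ((1 - l) / l) • ((p + l • (z - p) + e) - (p + (1 - l)⁻¹ • e)) := by
  have h : 1 - l ≠ 0 := by linarith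
  have h1 : (p + l • (z - p) + e) - (p + (1 - l)⁻¹ • e) = l • (z - p) + (1 - (1 - l)⁻¹) • e := by
    module
  rw [h1, smul_add, smul_smul, smul_smul]
  have e1 : (1 - l) / l * l = 1 - l := by field_simp
  have e2 : (1 - l) / l * (1 - (1 - l)⁻¹) = -1 := by field_simp; ring
  rw [e1, e2]
  module

theorem cone_bound {B : Set (X × (X →L[ℝ] ℝ))} (hB : IsMonotoneOp B) {p z e : X} {δ M l : ℝ}
    (hdom : Metric.ball p δ ⊆ opDom B)
    (hM : ∀ y ys, (y, ys) ∈ B → y ∈ Metric.ball p δ → ‖ys‖ ≤ M)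
    (hl : 0 ≤ l) (hl1 : l < 1) (he : ‖e‖ < δ * (1 - l)) {bs : X →L[ℝ] ℝ}
    (hb : (p + l • (z - p) + e, bs) ∈ B) :
    -(M * ‖z - (p + l • (z - p) + e)‖) ≤ bs (z - (p + l • (z - p) + e)) := by
  rcases hl.eq_or_lt with rfl | hl
  · have h1 := hM _ _ hb (by simpa [dist_eq_norm] using he)
    set a := p + (0 : ℝ) • (z - p) + e
    have : |bs (z - a)| ≤ M * ‖z - a‖ := (bs.le_opNorm _).trans (by gcongr)
    exact (abs_le.1 this).1
  · have heq := cone_eq (p := p) (z := z) (e := e) hl hl1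
    set a := p + l • (z - p) + e
    set y := p + (1 - l)⁻¹ • e with hy
    have h1l : 0 < 1 - l := by linarith
    have hyb : y ∈ Metric.ball p δ := by
      rw [Metric.mem_ball, dist_eq_norm, hy, add_sub_cancel_left, norm_smul, norm_inv,
        Real.norm_of_nonneg h1l.le, inv_mul_lt_iff₀ h1l]
      linarith
    obtain ⟨ys, hys⟩ := hdom hyb
    have h1 := hM _ _ hys hyb
    have h2 := hB _ hb _ hys
    rw [_root_.sub_apply] at h2
    simp only at h2
    have hk : 0 < (1 - l) / l := by positivity
    have h3 : ys (z - a) ≤ bs (z - a) := by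
      rw [heq, map_smul, map_smul, smul_eq_mul, smul_eq_mul]
      gcongr
      linarith
    have : |ys (z - a)| ≤ M * ‖z - a‖ := (ys.le_opNorm _).trans (by gcongr)
    linarith [(abs_le.1 this).1]

/-- finiteness of the Fitzpatrick function of the sum forces `z ∈ cl(dom A)`. -/
theorem mem_closure_domA_of_fitz_lt_top {X : Type*} [NormedAddCommGroup X] [NormedSpace ℝ X]
    [CompleteSpace X]
    (A B : Set (X × (X →L[ℝ] ℝ)))
    (hFPV : IsFPV A) (hB : IsMaxMonotoneOp B)
    (hstar : (starSet (opDom A) ∩ interior (opDom B)).Nonempty)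
    (z : X) (zs : X →L[ℝ] ℝ)
    (hfin : fitz (opSum A B) (z, zs) < ⊤) :
    z ∈ closure (opDom A) := by
  obtain ⟨p, ⟨hpA, hpstar⟩, hpB⟩ := hstar
  -- real bound
  obtain ⟨R, hR⟩ : ∃ R : ℝ, ∀ a as bs, (a, as) ∈ A → (a, bs) ∈ B →
      as (z - a) + bs (z - a) + zs a ≤ R := by
    obtain ⟨R, hR, -⟩ := EReal.lt_iff_exists_real_btwn.1 hfin
    refine ⟨R, fun a as bs ha hb => ?_⟩
    have h1 : (a, as + bs) ∈ opSum A B := ⟨as, bs, ha, hb, rfl⟩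
    have h2 : (((as + bs) z + zs a - (as + bs) a : ℝ) : EReal) ≤ fitz (opSum A B) (z, zs) :=
      le_iSup₂ (f := fun (q : X × (X →L[ℝ] ℝ)) (_ : q ∈ opSum A B) =>
        ((q.2 z + zs q.1 - q.2 q.1 : ℝ) : EReal)) (a, as + bs) h1
    have h3 := EReal.coe_lt_coe_iff.1 (h2.trans_lt hR)
    simp only [_root_.add_apply, map_sub] at h3 ⊢
    linarith
  by_contra hz
  obtain ⟨d, hd, hdz⟩ : ∃ d > 0, ∀ a ∈ opDom A, d ≤ ‖z - a‖ := by
    rw [Metric.mem_closure_iff] at hz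
    push Not at hz
    obtain ⟨d, hd, h⟩ := hz
    exact ⟨d, hd, fun a ha => by rw [← dist_eq_norm]; exact h a ha⟩
  obtain ⟨δ, hδ, M, hM0, hdom, hM⟩ := loc_bdd hB.1 hpB
  have hzp : 0 < ‖z - p‖ := hd.trans_le (hdz p hpA)
  let κ := d / (2 * ‖z - p‖)
  have hκ : 0 < κ := by positivity
  let ε := min (d / 4) (δ * κ)
  have hε : 0 < ε := by positivity
  let L := ‖z - p‖ + ε
  have hL : 0 < L := by positivity
  let N := max 0 (R + ‖zs‖ * (‖p‖ + L) + M * (‖z - p‖ + L) + 1)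
  obtain ⟨a, as, l, e, haA, hl0, hl1, hae, hen, hNa, hdl⟩ :=
    find_a hFPV hd hpA hdz ε N hε (min_le_left _ _) (le_max_left _ _)
  have hlκ : κ ≤ 1 - l := by
    simp only [κ]
    rw [div_le_iff₀ (by positivity)]
    linarith
  have hl1' : l < 1 := by linarith
  have heδ : ‖e‖ < δ * (1 - l) := hen.trans_le ((min_le_right _ _).trans (by gcongr))
  have hap : ‖a - p‖ ≤ L := by
    have : a - p = l • (z - p) + e := by rw [hae]; abel
    rw [this]
    refine (norm_add_le _ _).trans ?_
    rw [norm_smul, Real.norm_of_nonneg hl0]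
    simp only [L]
    nlinarith
  -- `a` is not in the domain of `B`
  have haB : a ∉ opDom B := by
    rintro ⟨bs, hb⟩
    have h1 := hR a as bs haA hb
    have h2 : -(M * ‖z - a‖) ≤ bs (z - a) := by
      have hb' := hb
      rw [hae] at hb'
      have := cone_bound hB.1 hdom hM hl0 hl1' heδ hb'
      rwa [← hae] at this
    have h3 : ‖z - a‖ ≤ ‖z - p‖ + L := by
      have : z - a = (z - p) - (a - p) := by abel
      rw [this]
      exact (norm_sub_le _ _).trans (by linarith)
    have h4 : ‖a‖ ≤ ‖p‖ + L := by
      have : a = p + (a - p) := by abel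
      rw [this]
      exact (norm_add_le _ _).trans (by linarith)
    have h5 : |zs a| ≤ ‖zs‖ * (‖p‖ + L) := (zs.le_opNorm _).trans (by gcongr)
    have h6 := (abs_le.1 h5).1
    have h7 : M * ‖z - a‖ ≤ M * (‖z - p‖ + L) := by gcongr
    have h8 : R + ‖zs‖ * (‖p‖ + L) + M * (‖z - p‖ + L) + 1 ≤ N := le_max_right _ _
    linarith
  -- the exit point
  let C := convexHull ℝ (opDom B)
  have hCc : Convex ℝ C := convex_convexHull ℝ _
  have hCB : interior C ⊆ opDom B := int_hull_sub hB hδ hdom hM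
  have hballC : Metric.ball p δ ⊆ interior C :=
    interior_maximal (hdom.trans (subset_convexHull ℝ _)) Metric.isOpen_ball
  let Q : ℝ → X := fun t => p + t • (a - p)
  have hQc : Continuous Q := by fun_prop
  have hTc : IsCompact (Icc (0 : ℝ) 1 ∩ Q ⁻¹' (interior C)ᶜ) :=
    isCompact_Icc.inter_right (isOpen_interior.isClosed_compl.preimage hQc)
  obtain ⟨t, ⟨⟨ht0, ht1⟩, htC⟩, htmin⟩ := hTc.exists_isLeast ⟨1, by
    refine ⟨by simp, ?_⟩
    simp only [Q, mem_preimage, mem_compl_iff, one_smul, add_sub_cancel]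
    exact fun h => haB (hCB h)⟩
  have htC : Q t ∉ interior C := htC
  have ht0 : 0 < t := by
    rcases ht0.eq_or_lt with rfl | h
    · exact absurd (hballC (by simp [Q, hδ])) htC
    · exact h
  have hl0 : 0 < l := by
    rcases hl0.eq_or_lt with rfl | h
    · refine absurd (hdom ?_) haB
      rw [hae, Metric.mem_ball, dist_eq_norm]
      simpa using heδ
    · exact h
  have hqcl : Q t ∈ closure C := by
    have h1 : Tendsto Q (𝓝[<] t) (𝓝 (Q t)) := (hQc.tendsto t).mono_left nhdsWithin_le_nhds
    refine mem_closure_of_tendsto h1 ?_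
    filter_upwards [Ioo_mem_nhdsLT ht0] with s hs
    by_contra hcon
    have := htmin (show s ∈ Icc (0 : ℝ) 1 ∩ Q ⁻¹' (interior C)ᶜ from
      ⟨⟨hs.1.le, by linarith [hs.2]⟩, fun h => hcon (interior_subset h)⟩)
    linarith [hs.2]
  set q := Q t with hq
  have hqa : q ∈ opDom A := hpstar a ⟨as, haA⟩ (by
    rw [segment_eq_image']
    exact ⟨t, ⟨ht0.le, ht1⟩, rfl⟩)
  have hqseg : segment ℝ p q ⊆ opDom A := hpstar q hqa
  obtain ⟨qs, hqs⟩ := hqa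
  obtain ⟨ps, hps⟩ := hpA
  -- cone representation of `q`
  let l' := t * l
  let e' := t • e
  have hqe : q = p + l' • (z - p) + e' := by
    simp only [hq, Q, hae, l', e']
    module
  have hl'0 : 0 < l' := mul_pos ht0 hl0
  have hl'l : l' ≤ l := by simp only [l']; nlinarith
  have hl'1 : l' < 1 := by linarith
  have he' : ‖e'‖ < δ * (1 - l') := by
    simp only [e']
    rw [norm_smul, Real.norm_of_nonneg ht0.le]
    have : δ * (1 - l) ≤ δ * (1 - l') := by gcongr
    nlinarith [norm_nonneg e]
  have hcone := cone_eq (p := p) (z := z) (e := e') hl'0 hl'1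
  rw [← hqe] at hcone
  set k := (1 - l') / l' with hk
  set y₀ := p + (1 - l')⁻¹ • e' with hy₀
  have h1l : 0 < 1 - l' := by linarith
  have hk0 : 0 < k := by positivity
  have hy₀b : ‖y₀ - p‖ < δ := by
    rw [hy₀, add_sub_cancel_left, norm_smul, norm_inv,
      Real.norm_of_nonneg h1l.le, inv_mul_lt_iff₀ h1l]
    linarith
  by_cases hqB : q ∈ opDom B
  · -- normal cone case
    obtain ⟨bs, hbs⟩ := hqB
    obtain ⟨f, hf⟩ := geometric_hahn_banach_open_point hCc.interior isOpen_interior htC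
    have hfB : ∀ y ∈ opDom B, f y ≤ f q := by
      intro y hy
      have h1 : y ∈ closure (interior C) := by
        rw [hCc.closure_interior_eq_closure_of_nonempty_interior
          ⟨p, hballC (Metric.mem_ball_self hδ)⟩]
        exact subset_closure (subset_convexHull ℝ _ hy)
      exact closure_minimal (t := {w | f w ≤ f q}) (fun w hw => (hf w hw).le)
        (isClosed_le f.continuous continuous_const) h1
    have hfz : 0 < f (z - q) := by
      rw [hcone, map_smul, smul_eq_mul, map_sub]
      have := hf y₀ (hballC (by rw [Metric.mem_ball, dist_eq_norm]; exact hy₀b))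
      exact mul_pos hk0 (by linarith)
    have hray : ∀ s : ℝ, 0 ≤ s → (q, bs + s • f) ∈ B := by
      intro s hs
      refine max_mem hB _ _ fun y ys hy => ?_
      have h1 := hB.1 _ hbs _ hy
      have h2 := hfB y ⟨ys, hy⟩
      have h3 : 0 ≤ s * (f q - f y) := mul_nonneg hs (by linarith)
      simp only [_root_.sub_apply, _root_.add_apply, _root_.smul_apply, smul_eq_mul] at h1 ⊢
      rw [map_sub f]
      linarith
    let W := qs (z - q) + bs (z - q) + zs q
    let s := (|R - W| + 1) / f (z - q)
    have h1 := hR q qs _ hqs (hray s (by positivity))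
    simp only [_root_.add_apply, _root_.smul_apply, smul_eq_mul] at h1
    have h2 : s * f (z - q) = |R - W| + 1 := by simp only [s]; field_simp
    have h3 := le_abs_self (R - W)
    simp only [W] at h2 h3
    linarith
  · -- blow-up case
    apply hqB
    let γ := min (1 / 2) (δ / (2 * ‖z - p‖))
    have hγ : 0 < γ := by positivity
    have hγ1 : γ < 1 := (min_le_left _ _).trans_lt (by norm_num)
    have hγδ : γ * ‖z - p‖ < δ := by
      have : γ * ‖z - p‖ ≤ δ / (2 * ‖z - p‖) * ‖z - p‖ := by
        gcongr
        exact min_le_right _ _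
      have h2 : δ / (2 * ‖z - p‖) * ‖z - p‖ = δ / 2 := by field_simp
      linarith
    let D := ‖p - q‖ + δ
    have hD : 0 < D := by positivity
    let ρ := (δ - ‖y₀ - p‖) / 3
    have hρ : 0 < ρ := div_pos (by linarith) (by norm_num)
    let θ₀ := min (1 / 2) (ρ / ((1 + k⁻¹) * D))
    have hθ₀ : 0 < θ₀ := by positivity
    let E := γ⁻¹ * ((‖qs‖ + ‖ps‖) * D)
    let C4 := k⁻¹ * |R + E + ‖zs‖ * (‖p‖ + D)| + M * (D + δ)
    have main : ∀ θ, 0 < θ → θ ≤ θ₀ → ∃ a bs, (a, bs) ∈ B ∧ ‖a - q‖ ≤ θ * D ∧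
        ‖bs‖ ≤ C4 / ρ := by
      intro θ hθ hθθ
      have hθ1 : θ < 1 := hθθ.trans_lt ((min_le_left _ _).trans_lt (by norm_num))
      obtain ⟨a', as', y, ha'A, hy, ha', hlow⟩ :=
        find_b hFPV (z := z) hδ hγ hγ1 hγδ hps hqs hqseg θ hθ hθ1
      have hlow : -E ≤ as' (z - a') := hlow
      have ha'B : a' ∈ opDom B := by
        apply hCB
        rw [ha', add_comm]
        exact hCc.combo_interior_closure_mem_interior (hballC hy) hqcl hθ (by linarith) (by ring)
      obtain ⟨bs, hbs⟩ := ha'B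
      have hyp : ‖y - p‖ < δ := by rw [← dist_eq_norm]; exact hy
      have haq : ‖a' - q‖ ≤ θ * D := by
        have e1 : a' - q = θ • ((y - p) + (p - q)) := by rw [ha']; module
        rw [e1, norm_smul, Real.norm_of_nonneg hθ.le]
        have := norm_add_le (y - p) (p - q)
        simp only [D]
        gcongr
        linarith
      have hap : ‖a' - p‖ ≤ D := by
        have e1 : a' - p = (1 - θ) • (q - p) + θ • (y - p) := by rw [ha']; module
        rw [e1]
        refine (norm_add_le _ _).trans ?_
        rw [norm_smul, norm_smul, Real.norm_of_nonneg hθ.le,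
          Real.norm_of_nonneg (show 0 ≤ 1 - θ by linarith), norm_sub_rev q p]
        simp only [D]
        nlinarith [norm_nonneg (p - q)]
      refine ⟨a', bs, hbs, haq, norm_le_of_ball bs hρ fun v hv => ?_⟩
      let y' := a' - k⁻¹ • (z - a')
      have hy'0 : y' - y₀ = (1 + k⁻¹) • (a' - q) := by
        have e1 : y₀ = q - k⁻¹ • (z - q) := by
          rw [hcone, smul_smul, inv_mul_cancel₀ hk0.ne', one_smul]
          abel
        rw [e1]
        simp only [y']
        module
      have hy'n : ‖y' - y₀‖ ≤ ρ := by
        rw [hy'0, norm_smul, Real.norm_of_nonneg (by positivity)]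
        have h1 : θ ≤ ρ / ((1 + k⁻¹) * D) := hθθ.trans (min_le_right _ _)
        rw [le_div_iff₀ (by positivity)] at h1
        calc (1 + k⁻¹) * ‖a' - q‖ ≤ (1 + k⁻¹) * (θ * D) := by gcongr
          _ = θ * ((1 + k⁻¹) * D) := by ring
          _ ≤ ρ := h1
      have hyv : ‖y' + v - p‖ < δ := by
        have e1 : y' + v - p = (y' - y₀) + v + (y₀ - p) := by abel
        rw [e1]
        have h1 := norm_add_le ((y' - y₀) + v) (y₀ - p)
        have h2 := norm_add_le (y' - y₀) v
        have h3 : 3 * ρ = δ - ‖y₀ - p‖ := by simp only [ρ]; ring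
        linarith
      have hyvb : y' + v ∈ Metric.ball p δ := by rw [Metric.mem_ball, dist_eq_norm]; exact hyv
      obtain ⟨ys, hys⟩ := hdom hyvb
      have hysM := hM _ _ hys hyvb
      have hmon := hB.1 _ hbs _ hys
      have e1 : a' - (y' + v) = k⁻¹ • (z - a') - v := by simp only [y']; abel
      have h1 : |ys (a' - (y' + v))| ≤ M * (D + δ) := by
        refine (ys.le_opNorm _).trans ?_
        gcongr
        have e2 : a' - (y' + v) = (a' - p) - (y' + v - p) := by abel
        rw [e2]
        exact (norm_sub_le _ _).trans (by linarith)
      have h2 := (abs_le.1 h1).1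
      rw [_root_.sub_apply] at hmon
      simp only at hmon
      rw [show bs (a' - (y' + v)) = k⁻¹ * bs (z - a') - bs v by
        rw [e1, map_sub, map_smul, smul_eq_mul]] at hmon
      have h3 := hR a' as' bs ha'A hbs
      have h4 : |zs a'| ≤ ‖zs‖ * (‖p‖ + D) := by
        refine (zs.le_opNorm _).trans ?_
        gcongr
        have : a' = p + (a' - p) := by abel
        rw [this]
        exact (norm_add_le _ _).trans (by linarith)
      have h5 := (abs_le.1 h4).1
      have h6 : bs (z - a') ≤ |R + E + ‖zs‖ * (‖p‖ + D)| :=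
        le_trans (by linarith) (le_abs_self _)
      have h7 : k⁻¹ * bs (z - a') ≤ k⁻¹ * |R + E + ‖zs‖ * (‖p‖ + D)| := by gcongr
      simp only [C4]
      linarith
    have hθn : ∀ n : ℕ, 0 < θ₀ / ((n : ℝ) + 1) ∧ θ₀ / ((n : ℝ) + 1) ≤ θ₀ := fun n =>
      ⟨by positivity, div_le_self hθ₀.le (by linarith [Nat.cast_nonneg (α := ℝ) n])⟩
    choose an bn hab hanq hbn using fun n : ℕ => main _ (hθn n).1 (hθn n).2
    refine bdd_limit hB an bn hab ?_ hbn
    rw [tendsto_iff_norm_sub_tendsto_zero]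
    have hlim : Tendsto (fun n : ℕ => θ₀ / ((n : ℝ) + 1) * D) atTop (𝓝 0) := by
      have h1 := (tendsto_one_div_add_atTop_nhds_zero_nat (𝕜 := ℝ)).const_mul (θ₀ * D)
      rw [mul_zero] at h1
      refine h1.congr fun n => ?_
      ring
    exact squeeze_zero (fun n => norm_nonneg _) hanq hlim
end
end

section
/- Let X be a real Banach space, let A : X ⇉ X* be of type (FPV), and let B : X ⇉ X* be maximally monotone. Assume 0 ∈ dom A ∩ int(dom B) and (0, 0) ∈ gra A ∩ gra B. Let (z, z*) ∈ X × X* with z in the norm closure of dom B and F_{A+B}(z, z*) < +∞. Then for every t ∈ (0, 1): t z ∈ int(dom B) and F_{A+B}(t z, t z*) ≥ t² ⟨z, z*⟩. -/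
open Set Filter Topology

noncomputable section

variable {X : Type*} [NormedAddCommGroup X] [NormedSpace ℝ X]

lemma fss_norm_bound {X : Type*} [NormedAddCommGroup X] [NormedSpace ℝ X]
    (f : X →L[ℝ] ℝ) (r K : ℝ) (hr : 0 < r) (h : ∀ u, ‖u‖ ≤ r → f u ≤ K) : ‖f‖ ≤ K / r := by
  have hK : 0 ≤ K := by simpa using h 0 (by simpa using hr.le)
  have key : ∀ x : X, f x ≤ K / r * ‖x‖ := by
    intro x
    by_cases hx : x = 0
    · simp [hx]
    have hx' : 0 < ‖x‖ := norm_pos_iff.mpr hx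
    have h1 := h ((r / ‖x‖) • x) (by
      rw [norm_smul, Real.norm_of_nonneg (by positivity)]
      exact (by field_simp : r / ‖x‖ * ‖x‖ = r).le)
    rw [map_smul, smul_eq_mul] at h1
    have h2 : f x = (r / ‖x‖ * f x) * (‖x‖ / r) := by field_simp
    rw [h2]
    calc _ ≤ K * (‖x‖ / r) := by gcongr
      _ = _ := by ring
  refine ContinuousLinearMap.opNorm_le_bound _ (by positivity) fun x => ?_
  rw [Real.norm_eq_abs, abs_le]
  have h1 := key x
  have h2 := key (-x)
  rw [map_neg, norm_neg] at h2
  constructor <;> linarith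

lemma fss_mem_of_related {X : Type*} [NormedAddCommGroup X] [NormedSpace ℝ X]
    {B : Set (X × (X →L[ℝ] ℝ))} (hB : IsMaxMonotoneOp B) (p : X × (X →L[ℝ] ℝ))
    (h : ∀ q ∈ B, 0 ≤ (p.2 - q.2) (p.1 - q.1)) : p ∈ B := by
  have := hB.2 (insert p B) (by
    rintro a (rfl | ha) b (rfl | hb)
    · simp
    · exact h b hb
    · have := h a ha
      simp only [ContinuousLinearMap.sub_apply, map_sub] at this ⊢
      linarith
    · exact hB.1 a ha b hb) (subset_insert _ _)
  rw [← this]; exact mem_insert _ _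

lemma fss_locbdd {X : Type*} [NormedAddCommGroup X] [NormedSpace ℝ X] [CompleteSpace X]
    {B : Set (X × (X →L[ℝ] ℝ))} (hB : IsMonotoneOp B) (h0 : (0 : X) ∈ interior (opDom B)) :
    ∃ ρ > 0, ∃ M : ℝ, 0 ≤ M ∧ (∀ y : X, ‖y‖ < ρ → y ∈ opDom B) ∧
      ∀ p ∈ B, ‖p.1‖ < ρ → ‖p.2‖ ≤ M := by
  obtain ⟨R, hR, hball⟩ := Metric.mem_nhds_iff.1 (mem_interior_iff_mem_nhds.1 h0)
  have hdom : ∀ y : X, ‖y‖ < R → y ∈ opDom B := fun y hy => hball (by simpa using hy)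
  let C : ℕ → Set X := fun n => {x | ∀ p ∈ B, ‖p.1‖ ≤ 1 → p.2 (x - p.1) ≤ n}
  have hCcl : ∀ n, IsClosed (C n) := by
    intro n
    have : C n = ⋂ p ∈ B, ⋂ _ : ‖p.1‖ ≤ 1, {x | p.2 (x - p.1) ≤ n} := by
      ext x; simp [C]
    rw [this]
    refine isClosed_biInter fun p _ => isClosed_iInter fun _ => isClosed_le (by fun_prop) (by fun_prop)
  have hCdom : ∀ x ∈ opDom B, ∃ n, x ∈ C n := by
    rintro x ⟨xs, hx⟩
    obtain ⟨n, hn⟩ := exists_nat_ge (‖xs‖ * (‖x‖ + 1))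
    refine ⟨n, fun p hp hp1 => ?_⟩
    have h1 := hB _ hx p hp
    simp only [ContinuousLinearMap.sub_apply] at h1
    have h2 : xs (x - p.1) ≤ ‖xs‖ * ‖x - p.1‖ := (le_abs_self _).trans (xs.le_opNorm _)
    have h3 : ‖x - p.1‖ ≤ ‖x‖ + 1 := (norm_sub_le _ _).trans (by linarith)
    have h4 : ‖xs‖ * ‖x - p.1‖ ≤ ‖xs‖ * (‖x‖ + 1) := by gcongr
    linarith
  let D : ℕ × ℕ → Set X := fun i => (fun x : X => (1 / ((i.1 : ℝ) + 1)) • x) ⁻¹' (C i.2)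
  obtain ⟨⟨k, m⟩, a, ha⟩ := nonempty_interior_of_iUnion_of_closed (f := D)
    (fun i => (hCcl i.2).preimage (by fun_prop)) (by
      rw [eq_univ_iff_forall]
      intro x
      obtain ⟨k, hk⟩ := exists_nat_gt (‖x‖ / R)
      have hk1 : (0 : ℝ) < k + 1 := by positivity
      obtain ⟨m, hm⟩ := hCdom ((1 / ((k : ℝ) + 1)) • x) (hdom _ (by
        rw [norm_smul, Real.norm_of_nonneg (by positivity), one_div_mul_eq_div, div_lt_iff₀ hk1]
        rw [div_lt_iff₀ hR] at hk
        nlinarith))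
      exact mem_iUnion.2 ⟨(k, m), hm⟩)
  obtain ⟨r0, hr0, hball0⟩ := Metric.mem_nhds_iff.1 (mem_interior_iff_mem_nhds.1 ha)
  have hk1 : (0 : ℝ) < k + 1 := by positivity
  set a' := (1 / ((k : ℝ) + 1)) • a with ha'
  obtain ⟨r, hr, hC⟩ : ∃ r > 0, ∀ u : X, ‖u‖ < r → a' + u ∈ C m := by
    refine ⟨r0 / (k + 1), by positivity, fun u hu => ?_⟩
    have : a + ((k : ℝ) + 1) • u ∈ D (k, m) := hball0 (by
      rw [mem_ball_iff_norm, add_sub_cancel_left, norm_smul, Real.norm_of_nonneg hk1.le]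
      rw [lt_div_iff₀ hk1] at hu
      linarith)
    have h2 : (1 / ((k : ℝ) + 1)) • (a + ((k : ℝ) + 1) • u) = a' + u := by
      rw [smul_add, smul_smul, one_div_mul_cancel hk1.ne', one_smul]
    simp only [D, mem_preimage] at this
    rwa [h2] at this
  obtain ⟨c, hc, hca⟩ : ∃ c : ℝ, 0 < c ∧ c * ‖a'‖ < R := by
    refine ⟨R / (‖a'‖ + 1), by positivity, ?_⟩
    rw [div_mul_eq_mul_div, div_lt_iff₀ (by positivity)]
    linarith
  obtain ⟨m', hm'⟩ := hCdom (-(c • a')) (hdom _ (by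
    rwa [norm_neg, norm_smul, Real.norm_of_nonneg hc.le]))
  let N : ℝ := (c * m + m') / c
  have hN : 0 ≤ N := by positivity
  refine ⟨min R (min 1 (c / (1 + c) * (r / 4))), by positivity, N / (r / 2), by positivity,
    fun y hy => hdom y (hy.trans_le (min_le_left _ _)), fun p hp hpn => ?_⟩
  have hp1 : ‖p.1‖ ≤ 1 := (hpn.trans_le ((min_le_right _ _).trans (min_le_left _ _))).le
  have hp2 : ‖p.1‖ < c / (1 + c) * (r / 4) :=
    hpn.trans_le ((min_le_right _ _).trans (min_le_right _ _))
  refine fss_norm_bound _ _ _ (by positivity) fun v hv => ?_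
  have h1 := hC (v + ((1 + c) / c) • p.1) (by
    refine (norm_add_le _ _).trans_lt ?_
    rw [norm_smul, Real.norm_of_nonneg (by positivity)]
    have : (1 + c) / c * ‖p.1‖ ≤ (1 + c) / c * (c / (1 + c) * (r / 4)) := by gcongr
    have h3 : (1 + c) / c * (c / (1 + c) * (r / 4)) = r / 4 := by field_simp
    linarith) p hp hp1
  have h2 := hm' p hp hp1
  simp only [map_add, map_sub, map_smul, map_neg, smul_eq_mul] at h1 h2
  rw [le_div_iff₀ hc]
  have h3 : c * (p.2 a' + (p.2 v + (1 + c) / c * p.2 p.1) - p.2 p.1) ≤ c * m := by gcongr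
  have h4 : c * (p.2 a' + (p.2 v + (1 + c) / c * p.2 p.1) - p.2 p.1)
    = c * p.2 a' + c * p.2 v + p.2 p.1 := by field_simp; ring
  linarith

/-- lifted graph -/
def fssG {X : Type*} [NormedAddCommGroup X] [NormedSpace ℝ X]
    (B : Set (X × (X →L[ℝ] ℝ))) : Set (X × (X →L[ℝ] ℝ) × ℝ) :=
  convexHull ℝ ((fun p : X × (X →L[ℝ] ℝ) => (p.1, p.2, p.2 p.1)) '' B)

lemma fss_G_ge {X : Type*} [NormedAddCommGroup X] [NormedSpace ℝ X]
    {B : Set (X × (X →L[ℝ] ℝ))} (hB : IsMonotoneOp B) (g : X × (X →L[ℝ] ℝ) × ℝ)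
    (hg : g ∈ fssG B) : g.2.1 g.1 ≤ g.2.2 := by
  have h1 : ∀ q ∈ B, ∀ g ∈ fssG B, g.2.1 q.1 + q.2 g.1 - q.2 q.1 ≤ g.2.2 := by
    intro q hq g hg
    have : fssG B ⊆ {g | g.2.1 q.1 + q.2 g.1 - q.2 q.1 ≤ g.2.2} := by
      refine convexHull_min ?_ ?_
      · rintro _ ⟨p, hp, rfl⟩
        have := hB p hp q hq
        simp at this ⊢
        linarith
      · intro x hx y hy s t hs ht hst
        simp only [mem_setOf_eq] at hx hy
        simp
        have e1 := mul_le_mul_of_nonneg_left hx hs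
        have e2 := mul_le_mul_of_nonneg_left hy ht
        have e3 : q.2 q.1 = (s + t) * q.2 q.1 := by rw [hst, one_mul]
        rw [e3]; linarith
    exact this hg
  have h2 : fssG B ⊆ {k | k.2.1 g.1 + g.2.1 k.1 - g.2.2 ≤ k.2.2} := by
    refine convexHull_min ?_ ?_
    · rintro _ ⟨p, hp, rfl⟩
      have := h1 p hp g hg
      simp
      linarith
    · intro x hx y hy s t hs ht hst
      simp only [mem_setOf_eq] at hx hy
      simp
      have e1 := mul_le_mul_of_nonneg_left hx hs
      have e2 := mul_le_mul_of_nonneg_left hy ht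
      have e3 : g.2.2 = (s + t) * g.2.2 := by rw [hst, one_mul]
      rw [e3]; linarith
  have := h2 hg
  simp only [mem_setOf_eq] at this
  linarith

lemma fss_mem_dom {X : Type*} [NormedAddCommGroup X] [NormedSpace ℝ X]
    {B : Set (X × (X →L[ℝ] ℝ))} (hB : IsMaxMonotoneOp B) (x : X) (δ M : ℝ) (hδ : 0 < δ)
    (h : ∀ w : X, ‖w‖ < δ → ∃ g ∈ fssG B, g.1 = x + w ∧ g.2.2 - g.2.1 x ≤ M) :
    x ∈ opDom B := by
  let E : Set (X × ℝ) := {e | ∃ g ∈ fssG B, g.1 = x + e.1 ∧ g.2.2 - g.2.1 x ≤ e.2}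
  have hEc : Convex ℝ E := by
    rintro e ⟨g, hg, hg1, hg2⟩ e' ⟨g', hg', hg1', hg2'⟩ s t hs ht hst
    refine ⟨s • g + t • g', convex_convexHull ℝ _ hg hg' hs ht hst, ?_, ?_⟩
    · simp only [Prod.fst_add, Prod.smul_fst, hg1, hg1', smul_add]
      have : x = s • x + t • x := by rw [← add_smul, hst, one_smul]
      nth_rewrite 3 [this]
      abel
    · simp
      have e1 := mul_le_mul_of_nonneg_left hg2 hs
      have e2 := mul_le_mul_of_nonneg_left hg2' ht
      linarith
  have hE0 : ∀ r : ℝ, ((0 : X), r) ∈ E → 0 ≤ r := by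
    rintro r ⟨g, hg, hg1, hg2⟩
    have := fss_G_ge hB.1 g hg
    simp only [add_zero] at hg1
    rw [hg1] at this
    simp only at hg2
    linarith
  have hEint : ((0 : X), M + 1) ∈ interior E := by
    rw [mem_interior]
    refine ⟨Metric.ball 0 δ ×ˢ Ioi M, ?_, Metric.isOpen_ball.prod isOpen_Ioi, by simp [hδ]⟩
    rintro ⟨w, r⟩ ⟨hw, hr⟩
    obtain ⟨g, hg, hg1, hg2⟩ := h w (by simpa using hw)
    exact ⟨g, hg, hg1, hg2.trans (le_of_lt hr)⟩
  have h0 : ((0 : X), (0 : ℝ)) ∉ interior E := by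
    intro h0
    have hc : Tendsto (fun r : ℝ => ((0 : X), r)) (𝓝 0) (𝓝 ((0 : X), (0 : ℝ))) :=
      (Continuous.tendsto (by fun_prop) _)
    obtain ⟨ε, hε, hh⟩ := Metric.mem_nhds_iff.1 (hc (mem_interior_iff_mem_nhds.1 h0))
    have : -(ε / 2) ∈ Metric.ball (0 : ℝ) ε := by
      rw [Metric.mem_ball, dist_zero_right, norm_neg, Real.norm_of_nonneg (by positivity)]
      linarith
    have := hE0 _ (hh this)
    linarith
  obtain ⟨f, hf⟩ := geometric_hahn_banach_point_open hEc.interior isOpen_interior h0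
  have hf0 : f ((0 : X), (0 : ℝ)) = 0 := map_zero f
  have hfE : ∀ e ∈ E, 0 ≤ f e := by
    intro e he
    have hsub : E ⊆ closure (interior E) := by
      rw [hEc.closure_interior_eq_closure_of_nonempty_interior ⟨_, hEint⟩]
      exact subset_closure
    have hcl : closure (interior E) ⊆ {e | 0 ≤ f e} :=
      closure_minimal (fun e he => by
        have := hf e he
        rw [hf0] at this
        exact this.le) (isClosed_le continuous_const f.continuous)
    exact hcl (hsub he)
  let u : X →L[ℝ] ℝ := f.comp (ContinuousLinearMap.inl ℝ X ℝ)
  let α : ℝ := f ((0 : X), (1 : ℝ))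
  have hsplit : ∀ (w : X) (r : ℝ), f (w, r) = u w + r * α := by
    intro w r
    have : (w, r) = (w, (0 : ℝ)) + r • ((0 : X), (1 : ℝ)) := by simp
    rw [this, map_add, map_smul]
    simp [u, α]
  have hM1 : 0 < (M + 1) * α := by
    have := hf _ hEint
    rw [hf0, hsplit] at this
    simpa using this
  have hM2 : 0 ≤ M := by
    apply hE0
    obtain ⟨g, hg, hg1, hg2⟩ := h 0 (by simpa using hδ)
    exact ⟨g, hg, hg1, hg2⟩
  have hα : 0 < α := by
    by_contra hα
    nlinarith
  refine ⟨-(α⁻¹ • u), fss_mem_of_related hB _ fun q hq => ?_⟩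
  have h1 := hfE (q.1 - x, q.2 q.1 - q.2 x)
    ⟨(q.1, q.2, q.2 q.1), subset_convexHull ℝ _ ⟨q, hq, rfl⟩, by simp, le_rfl⟩
  rw [hsplit] at h1
  simp only [map_sub] at h1
  simp only [ContinuousLinearMap.sub_apply, ContinuousLinearMap.neg_apply,
    ContinuousLinearMap.smul_apply, map_sub, smul_eq_mul]
  have h2 : -(α⁻¹ * (u x - u q.1)) - (q.2 x - q.2 q.1) =
    α⁻¹ * (u q.1 - u x + (q.2 q.1 - q.2 x) * α) := by field_simp; ring
  have h3 : 0 ≤ α⁻¹ * (u q.1 - u x + (q.2 q.1 - q.2 x) * α) := by positivity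
  linarith

lemma fss_key {X : Type*} [NormedAddCommGroup X] [NormedSpace ℝ X] [CompleteSpace X]
    {B : Set (X × (X →L[ℝ] ℝ))} (hB : IsMaxMonotoneOp B) (h0 : (0 : X) ∈ interior (opDom B))
    (z : X) (hz : z ∈ closure (opDom B)) (t : ℝ) (ht0 : 0 < t) (ht1 : t < 1) :
    ∃ ε > 0, ∃ M : ℝ, 0 ≤ M ∧ ∀ s : ℝ, 0 ≤ s → s ≤ t → ∀ a : X, ‖a - s • z‖ < ε →
      ∃ b, (a, b) ∈ B ∧ ‖b‖ ≤ M := by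
  obtain ⟨ρ, hρ, M, hM, hdom, hbd⟩ := fss_locbdd hB.1 h0
  have ht1' : 0 < 1 - t := by linarith
  let η := (1 - t) * ρ / 4
  have hη : 0 < η := by positivity
  obtain ⟨z0, ⟨z0s, hz0⟩, hzz⟩ := Metric.mem_closure_iff.1 hz η hη
  rw [dist_eq_norm] at hzz
  -- uniform bounds
  let L : ℝ := 2 * ‖z0‖ + 2 * ρ
  have hL : 0 ≤ L := by positivity
  let K : ℝ := L * ‖z0s‖ + L * M
  have hK : 0 ≤ K := by positivity
  refine ⟨η, hη, K / ((1 - t) * (ρ / 4)), by positivity, fun s hs0 hst a ha => ?_⟩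
  have hs1 : 0 < 1 - s := by linarith
  obtain ⟨y, hy⟩ : ∃ y, y = (1 - s)⁻¹ • (a - s • z0) := ⟨_, rfl⟩
  have hay : a = s • z0 + (1 - s) • y := by
    rw [hy, smul_smul, mul_inv_cancel₀ hs1.ne', one_smul]; abel
  have hyn : ‖y‖ < ρ / 2 := by
    rw [hy, norm_smul, norm_inv, Real.norm_of_nonneg hs1.le, inv_mul_lt_iff₀ hs1]
    have e : a - s • z0 = (a - s • z) + s • (z - z0) := by rw [smul_sub]; abel
    have e1 : ‖s • (z - z0)‖ ≤ ‖z - z0‖ := by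
      rw [norm_smul, Real.norm_of_nonneg hs0]
      exact mul_le_of_le_one_left (norm_nonneg _) (by linarith)
    have e2 : (1 - t) * (ρ / 2) ≤ (1 - s) * (ρ / 2) := by gcongr
    have e3 : η + η = (1 - t) * (ρ / 2) := by simp only [η]; ring
    rw [e]
    have := norm_add_le (a - s • z) (s • (z - z0))
    linarith
  have han : ‖a‖ ≤ ‖z0‖ + ρ := by
    rw [hay]
    refine (norm_add_le _ _).trans ?_
    rw [norm_smul, norm_smul, Real.norm_of_nonneg hs0, Real.norm_of_nonneg hs1.le]
    have e1 : s * ‖z0‖ ≤ 1 * ‖z0‖ := by gcongr; linarith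
    have e2 : (1 - s) * ‖y‖ ≤ 1 * ‖y‖ := by gcongr; linarith
    linarith
  have hb1 : z0s (z0 - a) ≤ L * ‖z0s‖ := by
    have e1 := (le_abs_self _).trans (z0s.le_opNorm (z0 - a))
    have e2 : ‖z0 - a‖ ≤ L := by
      have := norm_sub_le z0 a
      simp only [L]; linarith
    have e3 : ‖z0s‖ * ‖z0 - a‖ ≤ ‖z0s‖ * L := by gcongr
    linarith
  have hb2 : ∀ v : X, ‖v‖ < ρ / 2 → ∃ ys, (y + v, ys) ∈ B ∧ ys (y + v - a) ≤ L * M := by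
    intro v hv
    have hyv : ‖y + v‖ < ρ := (norm_add_le _ _).trans_lt (by linarith)
    obtain ⟨ys, hys⟩ := hdom _ hyv
    refine ⟨ys, hys, ?_⟩
    have e0 := hbd _ hys hyv
    simp only at e0
    have e1 := (le_abs_self _).trans (ys.le_opNorm (y + v - a))
    have e2 : ‖y + v - a‖ ≤ L := by
      have := norm_sub_le (y + v) a
      have := norm_nonneg z0
      simp only [L]; linarith
    have e3 : ‖ys‖ * ‖y + v - a‖ ≤ M * L := by gcongr
    linarith
  have hcomb : ∀ p q : ℝ, p ≤ L * ‖z0s‖ → q ≤ L * M → s * p + (1 - s) * q ≤ K := by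
    intro p q hp hq
    have e1 : s * p ≤ s * (L * ‖z0s‖) := by gcongr
    have e2 : (1 - s) * q ≤ (1 - s) * (L * M) := by gcongr
    have e3 : s * (L * ‖z0s‖) ≤ 1 * (L * ‖z0s‖) := by gcongr; linarith
    have e4 : (1 - s) * (L * M) ≤ 1 * (L * M) := by gcongr; linarith
    simp only [K]; linarith
  have hG : ∀ (x : X) (xs : X →L[ℝ] ℝ), (x, xs) ∈ B → (x, xs, xs x) ∈ fssG B :=
    fun x xs hx => subset_convexHull ℝ _ ⟨(x, xs), hx, rfl⟩
  have hmem : a ∈ opDom B := by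
    refine fss_mem_dom hB a ((1 - s) * (ρ / 2)) K (by positivity) fun w hw => ?_
    obtain ⟨ys, hys, hys2⟩ := hb2 ((1 - s)⁻¹ • w) (by
      rwa [norm_smul, norm_inv, Real.norm_of_nonneg hs1.le, inv_mul_lt_iff₀ hs1])
    set v := (1 - s)⁻¹ • w with hv
    refine ⟨s • (z0, z0s, z0s z0) + (1 - s) • (y + v, ys, ys (y + v)),
      convex_convexHull ℝ _ (hG _ _ hz0) (hG _ _ hys) hs0 hs1.le (by ring), ?_, ?_⟩
    · have : (1 - s) • v = w := by rw [hv, smul_smul, mul_inv_cancel₀ hs1.ne', one_smul]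
      simp only [Prod.fst_add, Prod.smul_fst, smul_add, this]
      rw [hay]; abel
    · have := hcomb _ _ hb1 hys2
      simp only [Prod.snd_add, Prod.smul_snd, Prod.fst_add, Prod.smul_fst,
        ContinuousLinearMap.add_apply, ContinuousLinearMap.smul_apply, smul_eq_mul]
      simp only [map_sub] at this
      linarith
  obtain ⟨b, hb⟩ := hmem
  refine ⟨b, hb, ?_⟩
  refine fss_norm_bound _ _ _ (by positivity) fun w hw => ?_
  obtain ⟨ys, hys, hys2⟩ := hb2 ((1 - s)⁻¹ • w) (by
      rw [norm_smul, norm_inv, Real.norm_of_nonneg hs1.le, inv_mul_lt_iff₀ hs1]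
      have e1 : (1 - t) * (ρ / 4) ≤ (1 - s) * (ρ / 4) := by gcongr
      have e2 : (1 - s) * (ρ / 4) < (1 - s) * (ρ / 2) := by gcongr; linarith
      linarith)
  have m1 := hB.1 _ hz0 _ hb
  have m2 := hB.1 _ hys _ hb
  simp only [ContinuousLinearMap.sub_apply] at m1 m2
  have := hcomb (b (z0 - a)) (b (y + (1 - s)⁻¹ • w - a)) (by linarith) (by linarith)
  have e : b w = s * b (z0 - a) + (1 - s) * b (y + (1 - s)⁻¹ • w - a) := by
    rw [hay]
    simp only [map_sub, map_add, map_smul, smul_eq_mul]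
    field_simp
    ring
  linarith

/-- scaling estimate for the Fitzpatrick function of the sum. -/
theorem fitz_sum_scaling {X : Type*} [NormedAddCommGroup X] [NormedSpace ℝ X] [CompleteSpace X]
    (A B : Set (X × (X →L[ℝ] ℝ)))
    (hFPV : IsFPV A) (hB : IsMaxMonotoneOp B)
    (h0 : (0 : X) ∈ opDom A ∩ interior (opDom B))
    (hgra0 : ((0 : X), (0 : X →L[ℝ] ℝ)) ∈ A ∩ B)
    (z : X) (zs : X →L[ℝ] ℝ)
    (hz : z ∈ closure (opDom B))
    (hfin : fitz (opSum A B) (z, zs) < ⊤) :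
    ∀ t : ℝ, 0 < t → t < 1 →
      t • z ∈ interior (opDom B) ∧
      ((t ^ 2 * zs z : ℝ) : EReal) ≤ fitz (opSum A B) (t • z, t • zs) := by
  intro t ht0 ht1
  obtain ⟨ε0, hε0, M, hM, hkey⟩ := fss_key hB h0.2 z hz t ht0 ht1
  refine ⟨?_, ?_⟩
  · rw [mem_interior_iff_mem_nhds, Metric.mem_nhds_iff]
    refine ⟨ε0, hε0, fun a ha => ?_⟩
    obtain ⟨b, hb, _⟩ := hkey t ht0.le le_rfl a (mem_ball_iff_norm.1 ha)
    exact ⟨b, hb⟩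
  have hle : ∀ a as bs, (a, as) ∈ A → (a, bs) ∈ B →
      (((as + bs) (t • z) + (t • zs) a - (as + bs) a : ℝ) : EReal)
        ≤ fitz (opSum A B) (t • z, t • zs) := by
    intro a as bs ha hb
    exact le_iSup₂_of_le (f := fun (q : X × (X →L[ℝ] ℝ)) (_ : q ∈ opSum A B) =>
      ((q.2 (t • z) + (t • zs) q.1 - q.2 q.1 : ℝ) : EReal)) (a, as + bs)
      ⟨as, bs, ha, hb, rfl⟩ le_rfl
  by_cases hA : t • z ∈ opDom A
  · obtain ⟨as, ha⟩ := hA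
    obtain ⟨bs, hb, _⟩ := hkey t ht0.le le_rfl (t • z) (by simpa using hε0)
    refine le_trans (le_of_eq ?_) (hle _ _ _ ha hb)
    congr 1
    simp only [ContinuousLinearMap.smul_apply, map_smul, smul_eq_mul]
    ring
  obtain ⟨j, hj1, hj⟩ := exists_dual_vector'' ℝ (t • z)
  have hj : j (t • z) = ‖t • z‖ := by simpa using hj
  have main : ∀ ε : ℝ, 0 < ε → ε ≤ ε0 →
      ((t ^ 2 * zs z - 2 * M * ε : ℝ) : EReal) ≤ fitz (opSum A B) (t • z, t • zs) := by
    intro ε hε hεε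
    let U := Metric.thickening ε (segment ℝ 0 (t • z))
    have hUsub : segment ℝ 0 (t • z) ⊆ U := Metric.self_subset_thickening hε _
    have hn : ¬ MonotonicallyRelated (A ∩ (U ×ˢ (univ : Set (X →L[ℝ] ℝ))))
        (t • z, t • zs + M • j) := by
      intro hrel
      exact hA ⟨_, hFPV.2 U Metric.isOpen_thickening ((convex_segment _ _).thickening _)
        ⟨0, hUsub (left_mem_segment _ _ _), h0.1⟩ _ _ (hUsub (right_mem_segment _ _ _)) hrel⟩
    unfold MonotonicallyRelated at hn
    push Not at hn
    obtain ⟨⟨a, as⟩, ⟨haA, haU, -⟩, hlt⟩ := hn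
    obtain ⟨c, hc, hac⟩ := Metric.mem_thickening_iff.1 haU
    rw [segment_eq_image] at hc
    obtain ⟨s, ⟨hs0, hs1⟩, rfl⟩ := hc
    simp only [smul_zero, zero_add, dist_eq_norm] at hac
    obtain ⟨bs, hb, hbM⟩ := hkey (s * t) (by positivity) (by nlinarith) a (by
      rw [mul_smul]; linarith)
    refine le_trans ?_ (hle _ _ _ haA hb)
    rw [EReal.coe_le_coe_iff]
    have f1 : |bs (t • z - a)| ≤ M * ‖t • z - a‖ :=
      (bs.le_opNorm _).trans (by gcongr)
    have f1 := (abs_le.1 f1).1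
    have f2 : t • z - a = (1 - s) • (t • z) - (a - s • t • z) := by
      rw [sub_smul, one_smul]; abel
    have f3 : ‖t • z - a‖ ≤ (1 - s) * ‖t • z‖ + ε := by
      rw [f2]
      refine (norm_sub_le _ _).trans ?_
      rw [norm_smul (1 - s), Real.norm_of_nonneg (by linarith)]
      linarith
    have f4 : j (a - s • t • z) ≤ ε := by
      refine (le_abs_self _).trans ((j.le_opNorm _).trans ?_)
      have : ‖j‖ * ‖a - s • t • z‖ ≤ 1 * ‖a - s • t • z‖ := by gcongr
      linarith
    have f5 : j (t • z - a) = (1 - s) * ‖t • z‖ - j (a - s • t • z) := by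
      rw [f2, map_sub, map_smul, hj, smul_eq_mul]
    have f6 : M * (‖t • z - a‖ - 2 * ε) ≤ M * j (t • z - a) := by
      gcongr
      linarith
    have f7 : (t • zs) (t • z) = t ^ 2 * zs z := by
      simp only [ContinuousLinearMap.smul_apply, map_smul, smul_eq_mul]; ring
    rw [← f7]
    simp only [ContinuousLinearMap.sub_apply, ContinuousLinearMap.add_apply] at hlt ⊢
    have f8 : (M • j) (t • z - a) = M * j (t • z - a) := rfl
    rw [f8] at hlt
    rw [map_sub (t • zs), map_sub as] at hlt
    rw [map_sub bs] at f1
    linarith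
  by_contra hcon
  rw [not_le] at hcon
  obtain ⟨r, hr1, hr2⟩ := EReal.lt_iff_exists_real_btwn.1 hcon
  rw [EReal.coe_lt_coe_iff] at hr2
  let ε := min ε0 ((t ^ 2 * zs z - r) / (2 * M + 1))
  have hε : 0 < ε := lt_min hε0 (div_pos (by linarith) (by linarith))
  have h1 := (main ε hε (min_le_left _ _)).trans_lt hr1
  rw [EReal.coe_lt_coe_iff] at h1
  have h2 : ε ≤ (t ^ 2 * zs z - r) / (2 * M + 1) := min_le_right _ _
  rw [le_div_iff₀ (by linarith)] at h2
  linarith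
end
end
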